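/- arXiv:math/0412282 — 4 statements merged into one kernel-verified Lean document; each statement's English description precedes it below -/
import Mathlib

section
/- Fix a field k and for a monomial set M (all monomials of degree at least 2) define F(M) = 1 + Σ_{S ∈ sat(M)} m_S (−z)^{c(S)+2} H̃(Δ'_S;k)(z), and F(I) = F(M_I) for a monomial ideal I. If I and I' are equivalent monomial ideals and f : L_I → L_{I'} is an equivalence, then f(F(I)) = F(I'), where f(F(I)) denotes applying f to the coefficients m_S of F(I) regarded as a polynomial in z. -/
noncomputable section
attribute [local instance] Classical.propDecidable

namespace MonomialRings

/-- Monomials in variables indexed by `σ`, represented by their exponent vectors. -/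
abbrev Mon (σ : Type*) := σ → ℕ

/-- Two monomials have a non-trivial common factor. -/
def NCF {σ : Type*} (a b : Mon σ) : Prop := ∃ i, a i ≠ 0 ∧ b i ≠ 0

/-- Adjacency in the graph associated to a set of monomials: edges go between distinct
monomials having a non-trivial common factor. -/
def mAdj {σ : Type*} (a b : Mon σ) : Prop := a ≠ b ∧ NCF a b

/-- `a` and `b` are joined by a path inside `S`. -/
def ConnIn {σ : Type*} (S : Finset (Mon σ)) (a b : Mon σ) : Prop :=
  a ∈ S ∧ b ∈ S ∧ Relation.ReflTransGen (fun u v => u ∈ S ∧ v ∈ S ∧ mAdj u v) a b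

/-- A monomial set is connected (in particular nonempty). -/
def IsConnected {σ : Type*} (S : Finset (Mon σ)) : Prop :=
  S.Nonempty ∧ ∀ a ∈ S, ∀ b ∈ S, ConnIn S a b

/-- The connected component of `a` in `S`. -/
def compOf {σ : Type*} (S : Finset (Mon σ)) (a : Mon σ) : Finset (Mon σ) :=
  S.filter (fun b => ConnIn S a b)

/-- The set of connected components of a monomial set. -/
def components {σ : Type*} (S : Finset (Mon σ)) : Finset (Finset (Mon σ)) :=
  S.image (compOf S)

/-- The number of connected components of a monomial set. -/
def ncomp {σ : Type*} (S : Finset (Mon σ)) : ℕ := (components S).card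

/-- The least common multiple `m_S` of a finite set of monomials (`m_∅ = 1`). -/
def mlcm {σ : Type*} (S : Finset (Mon σ)) : Mon σ := S.sup id

/-- `S` is saturated in `M`: for all `m ∈ M` and every connected subset `T ⊆ S`,
`m ∣ m_T` implies `m ∈ S`. -/
def Saturated {σ : Type*} (M S : Finset (Mon σ)) : Prop :=
  S ⊆ M ∧ ∀ m ∈ M, ∀ T ⊆ S, IsConnected T → m ≤ mlcm T → m ∈ S

/-- The set `sat M` of non-empty saturated subsets of `M`. -/
def satSets {σ : Type*} (M : Finset (Mon σ)) : Finset (Finset (Mon σ)) :=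
  M.powerset.filter (fun S => S.Nonempty ∧ Saturated M S)

/-- The saturation `S̄` of `S` in `M`. -/
def saturation {σ : Type*} (M S : Finset (Mon σ)) : Finset (Mon σ) :=
  M.filter (fun m => ∃ C ∈ components S, m ≤ mlcm C)

/-- The simplicial complex `Δ'_S`: faces are the `T ⊆ S` with `m_T ≠ m_S`, or such that
`S_i ∩ T` is disconnected for some connected component `S_i` of `S`. -/
def dprime {σ : Type*} (S : Finset (Mon σ)) : Set (Finset (Mon σ)) :=
  {T | T ⊆ S ∧ (mlcm T ≠ mlcm S ∨ ∃ C ∈ components S, ¬ IsConnected (C ∩ T))}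

/-- The simplicial complex `Δ_N`: faces are the `S ⊆ N` with `m_S ≠ m_N` or `S`
disconnected. -/
def dcomplex {σ : Type*} (N : Finset (Mon σ)) : Set (Finset (Mon σ)) :=
  {T | T ⊆ N ∧ (mlcm T ≠ mlcm N ∨ ¬ IsConnected T)}

/-- A discrete monomial set: the monomials are pairwise without common factors. -/
def Discrete {σ : Type*} (S : Finset (Mon σ)) : Prop :=
  ∀ a ∈ S, ∀ b ∈ S, a ≠ b → ¬ NCF a b

/-- The lcm-lattice of the monomial set `M` (as a finite set of monomials,
ordered by divisibility i.e. by `≤` on exponent vectors). -/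
def lcmLattice {σ : Type*} (M : Finset (Mon σ)) : Finset (Mon σ) :=
  M.powerset.image mlcm

/-- `M_l`: the set of monomials in `M` dividing the monomial `l`. -/
def divisorsIn {σ : Type*} (M : Finset (Mon σ)) (l : Mon σ) : Finset (Mon σ) :=
  M.filter (fun m => m ≤ l)

/-- `M_N`: the set of monomials in `M` dividing some monomial of `N`. -/
def divisorsInSet {σ : Type*} (M N : Finset (Mon σ)) : Finset (Mon σ) :=
  M.filter (fun m => ∃ l ∈ N, m ≤ l)

/-- An antichain of monomials (the minimal generating set of the monomial ideal
it generates). -/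
def IsAntichain' {σ : Type*} (M : Finset (Mon σ)) : Prop :=
  ∀ m ∈ M, ∀ n ∈ M, m ≤ n → m = n

/-- total degree of a monomial -/
def mdeg {t : ℕ} (m : Mon (Fin t)) : ℕ := ∑ i, m i

end MonomialRings
namespace MonomialRings

/-- An auxiliary (classically chosen) linear order on any type, used to orient simplices. -/
def vOrd (V : Type*) : LinearOrder V := IsWellOrder.linearOrder WellOrderingRel

/-- The position of a vertex `x` inside a face `F` (w.r.t. the auxiliary order). -/
def rankIn {V : Type*} (F : Finset V) (x : V) : ℕ :=
  (F.filter (fun y => (vOrd V).lt y x)).card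

/-- The boundary of a single oriented simplex. -/
def bdryAux (k : Type*) [Field k] {V : Type*} (F : Finset V) : Finset V →₀ k :=
  ∑ x ∈ F, ((-1 : k) ^ (rankIn F x)) • Finsupp.single (F.erase x) (1 : k)

/-- The simplicial boundary operator on the module spanned by all finite subsets of `V`. -/
def bdry (k : Type*) [Field k] (V : Type*) :
    (Finset V →₀ k) →ₗ[k] (Finset V →₀ k) :=
  Finsupp.linearCombination k (bdryAux k)

/-- The subspace of chains of a simplicial complex `Δ` spanned by the faces with `n`
vertices (i.e. of dimension `n - 1`). -/
def chainSub (k : Type*) [Field k] {V : Type*} (Δ : Set (Finset V)) (n : ℕ) :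
    Submodule k (Finset V →₀ k) :=
  Submodule.span k ((fun F => Finsupp.single F (1 : k)) '' {F | F ∈ Δ ∧ F.card = n})

/-- Reduced cycles of `Δ` in the degree of faces with `n` vertices. -/
def cycles (k : Type*) [Field k] {V : Type*} (Δ : Set (Finset V)) (n : ℕ) :
    Submodule k (Finset V →₀ k) :=
  chainSub k Δ n ⊓ LinearMap.ker (bdry k V)

/-- Reduced boundaries of `Δ` in the degree of faces with `n` vertices. -/
def bdries (k : Type*) [Field k] {V : Type*} (Δ : Set (Finset V)) (n : ℕ) :
    Submodule k (Finset V →₀ k) :=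
  Submodule.map (bdry k V) (chainSub k Δ (n + 1))

/-- `dim_k H̃_{n-1}(Δ; k)`: the dimension of the reduced homology of `Δ` in the degree of
faces with `n` vertices (homological dimension `n - 1`; `n = 0` corresponds to `H̃₋₁`). -/
def hdim (k : Type*) [Field k] {V : Type*} (Δ : Set (Finset V)) (n : ℕ) : ℕ :=
  Module.finrank k ↥(cycles k Δ n) - Module.finrank k ↥(bdries k Δ n)

/-- `hdim` with integer index (`0` below the allowed range). -/
def hdimZ (k : Type*) [Field k] {V : Type*} (Δ : Set (Finset V)) (n : ℤ) : ℕ :=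
  if 0 ≤ n then hdim k Δ n.toNat else 0

/-- The subquotient `K / (B ∩ K)` of a module, used to form homology. -/
def subquot (k : Type*) [Field k] {M : Type*} [AddCommGroup M] [Module k M]
    (K B : Submodule k M) :=
  ↥K ⧸ B.comap K.subtype

instance (k : Type*) [Field k] {M : Type*} [AddCommGroup M] [Module k M]
    (K B : Submodule k M) : AddCommGroup (subquot k K B) := by
  unfold subquot; infer_instance

instance (k : Type*) [Field k] {M : Type*} [AddCommGroup M] [Module k M]
    (K B : Submodule k M) : Module k (subquot k K B) := by
  unfold subquot; infer_instance

/-- The reduced homology `H̃_{n-1}(Δ; k)` itself, as a `k`-module. -/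
def homologyMod (k : Type*) [Field k] {V : Type*} (Δ : Set (Finset V)) (n : ℕ) :=
  subquot k (cycles k Δ n) (bdries k Δ n)

instance (k : Type*) [Field k] {V : Type*} (Δ : Set (Finset V)) (n : ℕ) :
    AddCommGroup (homologyMod k Δ n) := by
  unfold homologyMod; infer_instance

instance (k : Type*) [Field k] {V : Type*} (Δ : Set (Finset V)) (n : ℕ) :
    Module k (homologyMod k Δ n) := by
  unfold homologyMod; infer_instance

/-- The generating function `H̃(Δ;k)(z) = ∑ᵢ dim_k H̃ᵢ(Δ;k) zⁱ` of the reduced homology of a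
complex all of whose faces have at most `bound` vertices, as a Laurent polynomial
(the `H̃₋₁` term contributes `z⁻¹`). -/
def hgen (k : Type*) [Field k] {V : Type*} (Δ : Set (Finset V)) (bound : ℕ) :
    LaurentPolynomial ℤ :=
  ∑ n ∈ Finset.range (bound + 1), (hdim k Δ n : ℤ) • LaurentPolynomial.T ((n : ℤ) - 1)

/-- The order complex of a subset `P` of a partially ordered type: its faces are the finite
chains contained in `P`. -/
def orderComplex {V : Type*} [PartialOrder V] (P : Set V) : Set (Finset V) :=
  {F | ↑F ⊆ P ∧ IsChain (· ≤ ·) (F : Set V)}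

end MonomialRings
namespace MonomialRings

/-! ### The multigraded Poincaré series, via the bar resolution

For a monomial ring `R = k[x₁,…,x_t]/I`, the multigraded vector spaces `Tor^R_{i,α}(k,k)`
are computed by the (normalized) bar resolution of `k` over `R`.  The monomial ring is
determined by the set `J` of exponents of monomials lying in `I`; `R` has `k`-basis the
monomials `x^β` with `β ∉ J`, and the degree-`(i,α)` part of the bar complex has basis the
lists `[β₁,…,β_i]` of nonzero exponent vectors not in `J` with `β₁ + ⋯ + β_i = α`. -/

/-- Lists forming the basis of the multigraded piece of the bar complex. -/
def barBasis {σ : Type*} (J : Set (Mon σ)) (i : ℕ) (α : Mon σ) : Set (List (Mon σ)) :=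
  {l | l.length = i ∧ l.sum = α ∧ ∀ β ∈ l, β ≠ 0 ∧ β ∉ J}

/-- Merging the entries at positions `j` and `j+1` of a list. -/
def mergeAt {σ : Type*} (l : List (Mon σ)) (j : ℕ) : List (Mon σ) :=
  l.take j ++ [l.getD j 0 + l.getD (j + 1) 0] ++ l.drop (j + 2)

/-- The bar differential on a basis element. -/
def barAux (k : Type*) [Field k] {σ : Type*} (J : Set (Mon σ)) (l : List (Mon σ)) :
    List (Mon σ) →₀ k :=
  ∑ j ∈ Finset.range (l.length - 1),
    if l.getD j 0 + l.getD (j + 1) 0 ∉ J then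
      ((-1 : k) ^ (j + 1)) • Finsupp.single (mergeAt l j) (1 : k)
    else 0

/-- The bar differential. -/
def barD (k : Type*) [Field k] {σ : Type*} (J : Set (Mon σ)) :
    (List (Mon σ) →₀ k) →ₗ[k] (List (Mon σ) →₀ k) :=
  Finsupp.linearCombination k (barAux k J)

/-- The degree-`(i,α)` part of the bar complex. -/
def barSub (k : Type*) [Field k] {σ : Type*} (J : Set (Mon σ)) (i : ℕ) (α : Mon σ) :
    Submodule k (List (Mon σ) →₀ k) :=
  Submodule.span k ((fun l => Finsupp.single l (1 : k)) '' barBasis J i α)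

/-- `dim_k Tor^R_{i,α}(k,k)` for the monomial ring `R` determined by `J`. -/
def torDim (k : Type*) [Field k] {σ : Type*} (J : Set (Mon σ)) (i : ℕ) (α : Mon σ) : ℕ :=
  Module.finrank k ↥(barSub k J i α ⊓ LinearMap.ker (barD k J))
    - Module.finrank k ↥(Submodule.map (barD k J) (barSub k J (i + 1) α))

/-- The set of exponent vectors of monomials lying in the ideal `I`. -/
def expSet {t : ℕ} {k : Type*} [Field k] (I : Ideal (MvPolynomial (Fin t) k)) :
    Set (Mon (Fin t)) :=
  {β | MvPolynomial.monomial (Finsupp.equivFunOnFinite.symm β) (1 : k) ∈ I}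

/-- The exponent (in `ℕ^t × ℕ`) of the monomial `x^α z^d`; the extra variable `none`
is the homological variable `z`. -/
def expOf {t : ℕ} (α : Mon (Fin t)) (d : ℕ) : Option (Fin t) →₀ ℕ :=
  Finsupp.equivFunOnFinite.symm (fun o => Option.elim o d α)

/-- The multigraded Poincaré series
`P^R_k(x,z) = ∑_{i,α} dim_k Tor^R_{i,α}(k,k) x^α z^i` of the monomial ring `R`
determined by `J`, as a formal power series in `x₁,…,x_t` and `z` (the variable `none`). -/
def poincareSeries (k : Type*) [Field k] {t : ℕ} (J : Set (Mon (Fin t))) :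
    MvPowerSeries (Option (Fin t)) ℤ :=
  fun e => (torDim k J (e none) (fun i => e (some i)) : ℤ)

/-- The statement that `b` is the Backelin denominator of the Poincaré series:
`P^R_k(x,z) = ∏ᵢ(1+xᵢz) / b(x,z)`. -/
def IsDenominator (k : Type*) [Field k] {t : ℕ} (J : Set (Mon (Fin t)))
    (b : MvPolynomial (Option (Fin t)) ℤ) : Prop :=
  (b : MvPowerSeries (Option (Fin t)) ℤ) * poincareSeries k J
    = ∏ i : Fin t, (1 + MvPowerSeries.X (some i) * MvPowerSeries.X none)

/-- The multigraded ideal of a monomial set: the exponents `β` with `x^m ∣ x^β` for some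
`m ∈ M`. -/
def upperSet {σ : Type*} (M : Finset (Mon σ)) : Set (Mon σ) :=
  {β | ∃ m ∈ M, m ≤ β}

/-- `I` is the monomial ideal generated by the monomial set `M`. -/
def IsMonomialIdealOf {t : ℕ} {k : Type*} [Field k] (M : Finset (Mon (Fin t)))
    (I : Ideal (MvPolynomial (Fin t) k)) : Prop :=
  I = Ideal.span ((fun m => MvPolynomial.monomial (Finsupp.equivFunOnFinite.symm m) (1 : k)) '' ↑M)

/-- The specialization `b(z) = b(1,…,1,z)` of a polynomial in `x₁,…,x_t,z`. -/
def zSpecialize {t : ℕ} (b : MvPolynomial (Option (Fin t)) ℤ) : Polynomial ℤ :=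
  MvPolynomial.aeval (fun o : Option (Fin t) => Option.elim o Polynomial.X (fun _ => 1)) b

end MonomialRings
namespace MonomialRings

/-- The polynomial
`1 + ∑_{S ∈ sat(M)} m_S (-z)^{c(S)+2} H̃(Δ'_S;k)(z)`
of Theorem (main formula); the summand for `S` and homological dimension `n - 1`
contributes `(-1)^{c(S)} dim_k H̃_{n-1}(Δ'_S;k) · x^{m_S} z^{c(S)+n+1}`. -/
def bFormula (k : Type*) [Field k] {t : ℕ} (M : Finset (Mon (Fin t))) :
    MvPolynomial (Option (Fin t)) ℤ :=
  1 + ∑ S ∈ satSets M, ∑ n ∈ Finset.range (S.card + 1),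
      MvPolynomial.monomial (expOf (mlcm S) (ncomp S + n + 1))
        ((-1 : ℤ) ^ (ncomp S) * (hdim k (dprime S) n : ℤ))

end MonomialRings
namespace MonomialRings

/-- `f` is an equivalence of lcm-lattices: a bijection `L_M → L_N` which is simultaneously
an isomorphism of posets (divisibility) and of graphs (non-trivial common factors). -/
def IsEquivalence {σ σ' : Type*} (M : Finset (Mon σ)) (N : Finset (Mon σ'))
    (f : Mon σ → Mon σ') : Prop :=
  Set.BijOn f ↑(lcmLattice M) ↑(lcmLattice N) ∧
    (∀ a ∈ lcmLattice M, ∀ b ∈ lcmLattice M, a ≤ b ↔ f a ≤ f b) ∧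
    (∀ a ∈ lcmLattice M, ∀ b ∈ lcmLattice M, mAdj a b ↔ mAdj (f a) (f b))

end MonomialRings
namespace MonomialRings

/-- The result of applying `f` to the coefficients of a polynomial in `x` and `z`,
regarded as a polynomial in `z` whose coefficients are `ℤ`-linear combinations of
monomials `x^α`: every monomial `x^α z^d` is replaced by `f(x^α) z^d`. -/
def applyEquiv {t t' : ℕ} (f : Mon (Fin t) → Mon (Fin t'))
    (b : MvPolynomial (Option (Fin t)) ℤ) : MvPolynomial (Option (Fin t')) ℤ :=
  ∑ e ∈ b.support,
    MvPolynomial.monomial (expOf (f (fun i => e (some i))) (e none)) (b.coeff e)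

end MonomialRings
namespace MonomialRings

/-! ### Invariance of reduced homology under renaming of vertices -/

/-- The sign contributed by the pair `(x, y)` when the vertices are renamed along `f`. -/
def inversionSign (k : Type*) [Field k] {V W : Type*} (f : V → W) (x y : V) : k :=
  if (vOrd V).lt x y ∧ (vOrd W).lt (f y) (f x) then -1 else 1

/-- The sign comparing the orientation of `F` with the one of its image under `f`. -/
def orientSign (k : Type*) [Field k] {V W : Type*} (f : V → W) (F : Finset V) : k :=
  ∏ x ∈ F, ∏ y ∈ F, inversionSign k f x y

lemma inversionSign_mul_self (k : Type*) [Field k] {V W : Type*} (f : V → W) (x y : V) :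
    inversionSign k f x y * inversionSign k f x y = 1 := by
  unfold inversionSign
  split_ifs <;> simp

lemma orientSign_mul_self (k : Type*) [Field k] {V W : Type*} (f : V → W) (F : Finset V) :
    orientSign k f F * orientSign k f F = 1 := by
  simp [orientSign, ← Finset.prod_mul_distrib, inversionSign_mul_self]

lemma neg_one_pow_rankIn (k : Type*) [Field k] {V : Type*} (F : Finset V) (x : V) :
    (-1 : k) ^ rankIn F x = ∏ y ∈ F, if (vOrd V).lt y x then (-1 : k) else 1 := by
  simp [rankIn, Finset.prod_ite]

lemma inversionSign_mul_swap (k : Type*) [Field k] {V W : Type*} (f : V → W) {x y : V}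
    (hxy : y ≠ x) (hf : f y ≠ f x) :
    (if (vOrd W).lt (f y) (f x) then (-1 : k) else 1) *
        (inversionSign k f x y * inversionSign k f y x) =
      if (vOrd V).lt y x then (-1 : k) else 1 := by
  unfold inversionSign
  rcases @lt_or_gt_of_ne V (vOrd V) _ _ hxy with h | h <;>
    rcases @lt_or_gt_of_ne W (vOrd W) _ _ hf with h' | h' <;>
    simp [h, h', @lt_asymm V (vOrd V).toPreorder _ _ h, @lt_asymm W (vOrd W).toPreorder _ _ h']

lemma inversionSign_self (k : Type*) [Field k] {V W : Type*} (f : V → W) (x : V) :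
    inversionSign k f x x = 1 :=
  if_neg fun h => @lt_irrefl V (vOrd V).toPreorder x h.1

lemma neg_one_pow_rankIn_image_mul_orientSign (k : Type*) [Field k] {V W : Type*} (f : V → W)
    {F : Finset V} (hf : Set.InjOn f F) {x : V} (hx : x ∈ F) :
    (-1 : k) ^ rankIn (F.image f) (f x) * orientSign k f F =
      (-1 : k) ^ rankIn F x * orientSign k f (F.erase x) := by
  rw [neg_one_pow_rankIn, neg_one_pow_rankIn, Finset.prod_image hf]
  obtain ⟨G, hG, rfl⟩ : ∃ G, x ∉ G ∧ F = insert x G :=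
    ⟨F.erase x, Finset.notMem_erase x F, (Finset.insert_erase hx).symm⟩
  have hswap : ∏ y ∈ G, (if (vOrd V).lt y x then (-1 : k) else 1) =
      ∏ y ∈ G, (if (vOrd W).lt (f y) (f x) then (-1 : k) else 1) *
        (inversionSign k f x y * inversionSign k f y x) := by
    refine Finset.prod_congr rfl fun y hy => (inversionSign_mul_swap k f ?_ ?_).symm
    · rintro rfl
      exact hG hy
    · intro h
      have := hf (Finset.mem_coe.2 (Finset.mem_insert_of_mem hy))
        (Finset.mem_coe.2 (Finset.mem_insert_self x G)) h
      subst this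
      exact hG hy
  simp only [Finset.erase_insert hG, orientSign, Finset.prod_insert hG, hswap,
    Finset.prod_mul_distrib, inversionSign_self, @lt_irrefl V (vOrd V).toPreorder,
    @lt_irrefl W (vOrd W).toPreorder, if_false]
  ring

/-- The chain map induced by a renaming of the vertices, with the orientation signs. -/
def reindexChain (k : Type*) [Field k] {V W : Type*} (f : V → W) :
    (Finset V →₀ k) →ₗ[k] (Finset W →₀ k) :=
  Finsupp.linearCombination k
    fun F => orientSign k f F • Finsupp.single (F.image f) (1 : k)

lemma reindexChain_single (k : Type*) [Field k] {V W : Type*} (f : V → W) (F : Finset V) :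
    reindexChain k f (Finsupp.single F 1) =
      orientSign k f F • Finsupp.single (F.image f) (1 : k) := by
  simp [reindexChain]

lemma chainSub_eq_supported (k : Type*) [Field k] {V : Type*} (Δ : Set (Finset V)) (n : ℕ) :
    chainSub k Δ n = Finsupp.supported k k {F | F ∈ Δ ∧ F.card = n} :=
  (Finsupp.supported_eq_span_single k _).symm

lemma reindexChain_bdry_single (k : Type*) [Field k] {V W : Type*} (f : V → W) {F : Finset V}
    (hf : Set.InjOn f F) :
    reindexChain k f (bdry k V (Finsupp.single F 1)) =
      bdry k W (reindexChain k f (Finsupp.single F 1)) := by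
  simp only [reindexChain_single, bdry, map_smul, Finsupp.linearCombination_single, bdryAux,
    map_sum, Finset.smul_sum, smul_smul, one_mul]
  rw [Finset.sum_image hf]
  refine Finset.sum_congr rfl fun x hx => ?_
  rw [← neg_one_pow_rankIn_image_mul_orientSign k f hf hx, mul_comm]
  congr 2
  ext w
  simp only [Finset.mem_image, Finset.mem_erase]
  constructor
  · rintro ⟨y, ⟨hy, hyF⟩, rfl⟩
    exact ⟨fun h => hy (hf hyF hx h), y, hyF, rfl⟩
  · rintro ⟨hw, y, hyF, rfl⟩
    exact ⟨y, ⟨fun h => hw (h ▸ rfl), hyF⟩, rfl⟩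

/-- The chains supported on subsets of `S`. -/
def chainsOn (k : Type*) [Field k] {V : Type*} (S : Finset V) : Submodule k (Finset V →₀ k) :=
  Finsupp.supported k k {F | F ⊆ S}

lemma reindexChain_bdry (k : Type*) [Field k] {V W : Type*} (f : V → W) {S : Finset V}
    (hf : Set.InjOn f S) {c : Finset V →₀ k} (hc : c ∈ chainsOn k S) :
    reindexChain k f (bdry k V c) = bdry k W (reindexChain k f c) := by
  rw [chainsOn, Finsupp.supported_eq_span_single] at hc
  induction hc using Submodule.span_induction with
  | mem c hc =>
    obtain ⟨F, hF, rfl⟩ := hc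
    exact reindexChain_bdry_single k f (hf.mono (Finset.coe_subset.2 hF))
  | zero => simp
  | add a b _ _ ha hb => simp only [map_add, ha, hb]
  | smul r a _ ha => simp only [map_smul, ha]

lemma bdry_mem_chainsOn (k : Type*) [Field k] {V : Type*} {S : Finset V}
    {c : Finset V →₀ k} (hc : c ∈ chainsOn k S) : bdry k V c ∈ chainsOn k S := by
  rw [chainsOn, Finsupp.supported_eq_span_single] at hc
  induction hc using Submodule.span_induction with
  | mem c hc =>
    obtain ⟨F, hF, rfl⟩ := hc
    simp only [bdry, Finsupp.linearCombination_single, one_smul, bdryAux]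
    exact Submodule.sum_mem _ fun x _ => Submodule.smul_mem _ _
      (Finsupp.single_mem_supported k 1 ((Finset.erase_subset x F).trans hF))
  | zero => simp
  | add a b _ _ ha hb => simpa only [map_add] using Submodule.add_mem _ ha hb
  | smul r a _ ha => simpa only [map_smul] using Submodule.smul_mem _ r ha

lemma image_injOn_powerset {V W : Type*} {f : V → W} {S : Finset V} (hf : Set.InjOn f S) :
    Set.InjOn (Finset.image f) {F : Finset V | F ⊆ S} := by
  intro A hA B hB h
  have h' := congrArg (fun s : Finset W => (s : Set W)) h
  simp only [Finset.coe_image] at h'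
  exact Finset.coe_injective
    ((hf.image_eq_image_iff (Finset.coe_subset.2 hA) (Finset.coe_subset.2 hB)).1 h')

lemma reindexChain_image_apply (k : Type*) [Field k] {V W : Type*} {f : V → W} {S : Finset V}
    (hf : Set.InjOn f S) {c : Finset V →₀ k} (hc : c ∈ chainsOn k S) {F : Finset V}
    (hF : F ⊆ S) : reindexChain k f c (F.image f) = orientSign k f F * c F := by
  rw [chainsOn, Finsupp.supported_eq_span_single] at hc
  induction hc using Submodule.span_induction with
  | mem c hc =>
    obtain ⟨G, hG, rfl⟩ := hc
    rw [reindexChain_single]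
    by_cases h : G = F
    · simp [h]
    · have h' : G.image f ≠ F.image f := fun e => h (image_injOn_powerset hf hG hF e)
      simp [h, h']
  | zero => simp
  | add a b _ _ ha hb => simp only [map_add, Finsupp.add_apply, ha, hb, mul_add]
  | smul r a _ ha =>
    simp only [map_smul, Finsupp.smul_apply, ha, smul_eq_mul]
    ring

lemma reindexChain_injOn (k : Type*) [Field k] {V W : Type*} {f : V → W} {S : Finset V}
    (hf : Set.InjOn f S) : Set.InjOn (reindexChain k f) (chainsOn k S) := by
  intro a ha b hb h
  ext F
  by_cases hF : F ⊆ S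
  · have key := reindexChain_image_apply k hf ha hF
    rw [h, reindexChain_image_apply k hf hb hF] at key
    have h0 : orientSign k f F ≠ 0 := left_ne_zero_of_mul_eq_one (orientSign_mul_self k f F)
    exact (mul_left_cancel₀ h0 key).symm
  · have hz : ∀ c ∈ chainsOn k S, c F = 0 := fun c hc =>
      Finsupp.notMem_support_iff.1 fun h => hF (hc h)
    rw [hz a ha, hz b hb]

lemma finrank_map_reindexChain (k : Type*) [Field k] {V W : Type*} {f : V → W} {S : Finset V}
    (hf : Set.InjOn f S) {p : Submodule k (Finset V →₀ k)} (hp : p ≤ chainsOn k S) :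
    Module.finrank k (p.map (reindexChain k f)) = Module.finrank k p := by
  have hinj : Function.Injective ((reindexChain k f).domRestrict p) := fun a b h =>
    Subtype.ext (reindexChain_injOn k hf (hp a.2) (hp b.2) h)
  rw [← LinearMap.range_domRestrict]
  exact (LinearEquiv.ofInjective _ hinj).finrank_eq.symm

lemma chainSub_le_chainsOn (k : Type*) [Field k] {V : Type*} {S : Finset V}
    {Δ : Set (Finset V)} (hΔ : ∀ F ∈ Δ, F ⊆ S) (n : ℕ) : chainSub k Δ n ≤ chainsOn k S := by
  rw [chainSub_eq_supported]
  exact Finsupp.supported_mono fun F hF => hΔ F hF.1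

lemma map_reindexChain_chainSub (k : Type*) [Field k] {V W : Type*} {f : V → W} {S : Finset V}
    (hf : Set.InjOn f S) {Δ : Set (Finset V)} (hΔ : ∀ F ∈ Δ, F ⊆ S) (n : ℕ) :
    (chainSub k Δ n).map (reindexChain k f) = chainSub k (Finset.image f '' Δ) n := by
  have hcard : ∀ F ∈ Δ, (F.image f).card = F.card := fun F hF =>
    Finset.card_image_of_injOn (hf.mono (Finset.coe_subset.2 (hΔ F hF)))
  rw [chainSub, chainSub, Submodule.map_span]
  refine le_antisymm (Submodule.span_le.2 ?_) (Submodule.span_le.2 ?_)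
  · rintro _ ⟨_, ⟨F, ⟨hF, rfl⟩, rfl⟩, rfl⟩
    dsimp only
    rw [reindexChain_single]
    exact Submodule.smul_mem _ _ (Submodule.subset_span
      ⟨F.image f, ⟨⟨F, hF, rfl⟩, hcard F hF⟩, rfl⟩)
  · rintro _ ⟨_, ⟨⟨F, hF, rfl⟩, hn⟩, rfl⟩
    have : Finsupp.single (F.image f) (1 : k) =
        orientSign k f F • reindexChain k f (Finsupp.single F 1) := by
      rw [reindexChain_single, smul_smul, orientSign_mul_self, one_smul]
    dsimp only
    rw [this]
    exact Submodule.smul_mem _ _ (Submodule.subset_span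
      ⟨_, ⟨F, ⟨hF, (hcard F hF).symm.trans hn⟩, rfl⟩, rfl⟩)

lemma map_reindexChain_cycles (k : Type*) [Field k] {V W : Type*} {f : V → W} {S : Finset V}
    (hf : Set.InjOn f S) {Δ : Set (Finset V)} (hΔ : ∀ F ∈ Δ, F ⊆ S) (n : ℕ) :
    (cycles k Δ n).map (reindexChain k f) = cycles k (Finset.image f '' Δ) n := by
  rw [cycles, cycles, ← map_reindexChain_chainSub k hf hΔ]
  ext d
  constructor
  · rintro ⟨c, ⟨hc, hc0⟩, rfl⟩
    refine ⟨⟨c, hc, rfl⟩, ?_⟩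
    simp only [SetLike.mem_coe, LinearMap.mem_ker] at hc0 ⊢
    rw [← reindexChain_bdry k f hf (chainSub_le_chainsOn k hΔ n hc), hc0, map_zero]
  · rintro ⟨⟨c, hc, rfl⟩, hc0⟩
    have hcS := chainSub_le_chainsOn k hΔ n hc
    refine ⟨c, ⟨hc, ?_⟩, rfl⟩
    simp only [SetLike.mem_coe, LinearMap.mem_ker] at hc0 ⊢
    rw [← reindexChain_bdry k f hf hcS] at hc0
    exact reindexChain_injOn k hf (bdry_mem_chainsOn k hcS) (Submodule.zero_mem _)
      (hc0.trans (map_zero _).symm)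

lemma map_reindexChain_bdries (k : Type*) [Field k] {V W : Type*} {f : V → W} {S : Finset V}
    (hf : Set.InjOn f S) {Δ : Set (Finset V)} (hΔ : ∀ F ∈ Δ, F ⊆ S) (n : ℕ) :
    (bdries k Δ n).map (reindexChain k f) = bdries k (Finset.image f '' Δ) n := by
  rw [bdries, bdries, ← map_reindexChain_chainSub k hf hΔ]
  ext d
  constructor
  · rintro ⟨_, ⟨c, hc, rfl⟩, rfl⟩
    exact ⟨_, ⟨c, hc, rfl⟩, (reindexChain_bdry k f hf (chainSub_le_chainsOn k hΔ _ hc)).symm⟩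
  · rintro ⟨_, ⟨c, hc, rfl⟩, rfl⟩
    exact ⟨_, ⟨c, hc, rfl⟩, reindexChain_bdry k f hf (chainSub_le_chainsOn k hΔ _ hc)⟩

/-- Reduced homology does not depend on the names, or the auxiliary order, of the vertices. -/
theorem hdim_image (k : Type*) [Field k] {V W : Type*} {f : V → W} {S : Finset V}
    (hf : Set.InjOn f S) {Δ : Set (Finset V)} (hΔ : ∀ F ∈ Δ, F ⊆ S) (n : ℕ) :
    hdim k (Finset.image f '' Δ) n = hdim k Δ n := by
  have hcyc : cycles k Δ n ≤ chainsOn k S := inf_le_left.trans (chainSub_le_chainsOn k hΔ n)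
  have hbd : bdries k Δ n ≤ chainsOn k S := by
    rintro _ ⟨c, hc, rfl⟩
    exact bdry_mem_chainsOn k (chainSub_le_chainsOn k hΔ _ hc)
  rw [hdim, hdim, ← map_reindexChain_cycles k hf hΔ, ← map_reindexChain_bdries k hf hΔ,
    finrank_map_reindexChain k hf hcyc, finrank_map_reindexChain k hf hbd]

/-! ### Transport of monomial sets along an equivalence -/

/-- The restriction of `f` to `M` is injective, preserves the graph structure of `M`, and
preserves divisibility between least common multiples of subsets of `M`. -/
structure PreservesLcm {σ σ' : Type*} (M : Finset (Mon σ)) (f : Mon σ → Mon σ') : Prop where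
  injOn : Set.InjOn f M
  adj : ∀ a ∈ M, ∀ b ∈ M, mAdj a b ↔ mAdj (f a) (f b)
  mlcm_le : ∀ S ⊆ M, ∀ T ⊆ M, mlcm S ≤ mlcm T ↔ mlcm (S.image f) ≤ mlcm (T.image f)

lemma ConnIn.image {σ σ' : Type*} {S : Finset (Mon σ)} {f : Mon σ → Mon σ'}
    (hf : ∀ a ∈ S, ∀ b ∈ S, mAdj a b → mAdj (f a) (f b)) {a b : Mon σ} (h : ConnIn S a b) :
    ConnIn (S.image f) (f a) (f b) := by
  refine ⟨Finset.mem_image_of_mem f h.1, Finset.mem_image_of_mem f h.2.1, ?_⟩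
  exact h.2.2.lift f fun u v huv => ⟨Finset.mem_image_of_mem f huv.1,
    Finset.mem_image_of_mem f huv.2.1, hf u huv.1 v huv.2.1 huv.2.2⟩

namespace PreservesLcm

variable {σ σ' : Type*} {M S T : Finset (Mon σ)} {f : Mon σ → Mon σ'} {a b : Mon σ}

lemma mono (h : PreservesLcm M f) (hS : S ⊆ M) : PreservesLcm S f where
  injOn := h.injOn.mono (Finset.coe_subset.2 hS)
  adj a ha b hb := h.adj a (hS ha) b (hS hb)
  mlcm_le A hA B hB := h.mlcm_le A (hA.trans hS) B (hB.trans hS)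

lemma mlcm_eq (h : PreservesLcm M f) (hS : S ⊆ M) (hT : T ⊆ M) :
    mlcm (S.image f) = mlcm (T.image f) ↔ mlcm S = mlcm T := by
  rw [le_antisymm_iff, le_antisymm_iff, h.mlcm_le S hS T hT, h.mlcm_le T hT S hS]

lemma le_mlcm (h : PreservesLcm M f) (ha : a ∈ M) (hT : T ⊆ M) :
    a ≤ mlcm T ↔ f a ≤ mlcm (T.image f) := by
  simpa [mlcm] using h.mlcm_le {a} (Finset.singleton_subset_iff.2 ha) T hT

lemma connIn_image (h : PreservesLcm S f) (ha : a ∈ S) (hb : b ∈ S) :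
    ConnIn (S.image f) (f a) (f b) ↔ ConnIn S a b := by
  refine ⟨fun hab => ?_, ConnIn.image fun a ha b hb => (h.adj a ha b hb).1⟩
  have hinv := h.injOn.leftInvOn_invFunOn
  have hback : (S.image f).image (Function.invFunOn f S) = S := by
    rw [Finset.image_image]
    exact (Finset.image_congr fun x hx => hinv hx).trans Finset.image_id
  have := hab.image (f := Function.invFunOn f S) (by
    simp only [Finset.forall_mem_image]
    intro u hu v hv huv
    rw [hinv hu, hinv hv]
    exact (h.adj u hu v hv).2 huv)
  rwa [hback, hinv ha, hinv hb] at this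

lemma isConnected_image (h : PreservesLcm S f) : IsConnected (S.image f) ↔ IsConnected S := by
  simp only [IsConnected, Finset.image_nonempty, Finset.forall_mem_image]
  refine and_congr_right fun _ => forall₂_congr fun a ha => forall₂_congr fun b hb => ?_
  exact h.connIn_image ha hb

lemma compOf_image (h : PreservesLcm S f) (ha : a ∈ S) :
    compOf (S.image f) (f a) = (compOf S a).image f := by
  ext y
  simp only [compOf, Finset.mem_filter, Finset.mem_image]
  constructor
  · rintro ⟨⟨b, hb, rfl⟩, hab⟩
    exact ⟨b, ⟨hb, (h.connIn_image ha hb).1 hab⟩, rfl⟩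
  · rintro ⟨b, ⟨hb, hab⟩, rfl⟩
    exact ⟨⟨b, hb, rfl⟩, (h.connIn_image ha hb).2 hab⟩

lemma components_image (h : PreservesLcm S f) :
    components (S.image f) = (components S).image (Finset.image f) := by
  rw [components, components, Finset.image_image, Finset.image_image]
  exact Finset.image_congr fun a ha => h.compOf_image ha

end PreservesLcm

lemma subset_of_mem_components {σ : Type*} {S C : Finset (Mon σ)} (hC : C ∈ components S) :
    C ⊆ S := by
  obtain ⟨a, -, rfl⟩ := Finset.mem_image.1 hC
  exact Finset.filter_subset _ _

namespace PreservesLcm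

variable {σ σ' : Type*} {M S T : Finset (Mon σ)} {f : Mon σ → Mon σ'}

lemma ncomp_image (h : PreservesLcm S f) : ncomp (S.image f) = ncomp S := by
  rw [ncomp, h.components_image]
  exact Finset.card_image_of_injOn
    ((image_injOn_powerset h.injOn).mono fun C hC => subset_of_mem_components hC)

lemma dprime_image (h : PreservesLcm S f) :
    dprime (S.image f) = Finset.image f '' dprime S := by
  have hmem : ∀ T ⊆ S, (T.image f ∈ dprime (S.image f) ↔ T ∈ dprime S) := by
    intro T hT
    simp only [dprime, Set.mem_ofPred_eq, Finset.image_subset_image hT, hT, true_and, ne_eq,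
      h.mlcm_eq hT subset_rfl, h.components_image, Finset.exists_mem_image]
    refine or_congr_right (exists_congr fun C => and_congr_right fun hC => not_congr ?_)
    have hCS := subset_of_mem_components hC
    rw [← Finset.image_inter_of_injOn _ _ (h.injOn.mono ?_)]
    · exact (h.mono (Finset.inter_subset_right.trans hT)).isConnected_image
    · exact Set.union_subset (Finset.coe_subset.2 hCS) (Finset.coe_subset.2 hT)
  ext U
  constructor
  · intro hU
    obtain ⟨T, hT, rfl⟩ := Finset.subset_image_iff.1 hU.1
    exact ⟨T, (hmem T (Finset.coe_subset.1 hT)).1 hU, rfl⟩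
  · rintro ⟨T, hT, rfl⟩
    exact (hmem T hT.1).2 hT

lemma saturated_image (h : PreservesLcm M f) (hS : S ⊆ M) :
    Saturated (M.image f) (S.image f) ↔ Saturated M S := by
  simp only [Saturated, Finset.image_subset_image hS, hS, true_and, Finset.forall_mem_image]
  refine forall₂_congr fun m hm => ?_
  have hmem : f m ∈ S.image f ↔ m ∈ S := by
    simp only [Finset.mem_image]
    exact ⟨fun ⟨x, hx, hxm⟩ => h.injOn (hS hx) hm hxm ▸ hx, fun hmS => ⟨m, hmS, rfl⟩⟩
  rw [hmem]
  constructor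
  · intro H T hT hc hle
    exact H (T.image f) (Finset.image_subset_image hT)
      ((h.mono (hT.trans hS)).isConnected_image.2 hc) ((h.le_mlcm hm (hT.trans hS)).1 hle)
  · intro H U hU hc hle
    obtain ⟨T, hT, rfl⟩ := Finset.subset_image_iff.1 hU
    have hT := Finset.coe_subset.1 hT
    exact H T hT ((h.mono (hT.trans hS)).isConnected_image.1 hc)
      ((h.le_mlcm hm (hT.trans hS)).2 hle)

lemma satSets_image (h : PreservesLcm M f) :
    satSets (M.image f) = (satSets M).image (Finset.image f) := by
  ext U
  simp only [satSets, Finset.mem_filter, Finset.mem_powerset, Finset.mem_image]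
  constructor
  · rintro ⟨hU, hne, hsat⟩
    obtain ⟨S, hS, rfl⟩ := Finset.subset_image_iff.1 hU
    have hS := Finset.coe_subset.1 hS
    exact ⟨S, ⟨hS, Finset.image_nonempty.1 hne, (h.saturated_image hS).1 hsat⟩, rfl⟩
  · rintro ⟨S, ⟨hS, hne, hsat⟩, rfl⟩
    exact ⟨Finset.image_subset_image hS, hne.image f, (h.saturated_image hS).2 hsat⟩

lemma sum_satSets_image {A : Type*} [AddCommMonoid A] (h : PreservesLcm M f)
    (g : Finset (Mon σ') → A) :
    ∑ S ∈ satSets (M.image f), g S = ∑ S ∈ satSets M, g (S.image f) := by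
  rw [h.satSets_image, Finset.sum_image]
  exact (image_injOn_powerset h.injOn).mono fun S hS =>
    Finset.mem_powerset.1 (Finset.mem_filter.1 hS).1

lemma card_image (h : PreservesLcm S f) : (S.image f).card = S.card :=
  Finset.card_image_of_injOn h.injOn

lemma hdim_dprime_image (h : PreservesLcm S f) (k : Type*) [Field k] (n : ℕ) :
    hdim k (dprime (S.image f)) n = hdim k (dprime S) n := by
  rw [h.dprime_image]
  exact hdim_image k h.injOn (fun F hF => hF.1) n

end PreservesLcm

/-! ### Equivalences of lcm-lattices -/

lemma mlcm_mem_lcmLattice {σ : Type*} {M S : Finset (Mon σ)} (hS : S ⊆ M) :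
    mlcm S ∈ lcmLattice M :=
  Finset.mem_image_of_mem _ (Finset.mem_powerset.2 hS)

lemma exists_of_mem_lcmLattice {σ : Type*} {M : Finset (Mon σ)} {l : Mon σ}
    (hl : l ∈ lcmLattice M) : ∃ S ⊆ M, mlcm S = l := by
  simpa [lcmLattice] using hl

lemma mem_lcmLattice_of_mem {σ : Type*} {M : Finset (Mon σ)} {m : Mon σ} (hm : m ∈ M) :
    m ∈ lcmLattice M := by
  simpa [mlcm] using mlcm_mem_lcmLattice (Finset.singleton_subset_iff.2 hm)

lemma zero_mem_lcmLattice {σ : Type*} (M : Finset (Mon σ)) : 0 ∈ lcmLattice M :=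
  mlcm_mem_lcmLattice (Finset.empty_subset M)

lemma exists_mem_le_of_ne_zero {σ : Type*} {M : Finset (Mon σ)} {l : Mon σ}
    (hl : l ∈ lcmLattice M) (h0 : l ≠ 0) : ∃ m ∈ M, m ≤ l := by
  obtain ⟨S, hS, rfl⟩ := exists_of_mem_lcmLattice hl
  rcases S.eq_empty_or_nonempty with rfl | ⟨m, hm⟩
  · exact absurd rfl h0
  · exact ⟨m, hS hm, Finset.le_sup (f := id) hm⟩

namespace IsEquivalence

variable {σ σ' : Type*} {M : Finset (Mon σ)} {M' : Finset (Mon σ')} {f : Mon σ → Mon σ'}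

lemma symm (hf : IsEquivalence M M' f) :
    IsEquivalence M' M (Function.invFunOn f (lcmLattice M)) := by
  obtain ⟨hbij, hle, hadj⟩ := hf
  have hinv := hbij.invOn_invFunOn
  have hbij' := hbij.symm hinv.symm
  refine ⟨hbij', fun a ha b hb => ?_, fun a ha b hb => ?_⟩
  · rw [hle _ (hbij'.mapsTo ha) _ (hbij'.mapsTo hb), hinv.2 ha, hinv.2 hb]
  · rw [hadj _ (hbij'.mapsTo ha) _ (hbij'.mapsTo hb), hinv.2 ha, hinv.2 hb]

lemma map_zero (hf : IsEquivalence M M' f) : f 0 = 0 := by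
  obtain ⟨a, ha, ha0⟩ := hf.1.surjOn (zero_mem_lcmLattice M')
  have h0a : (0 : Mon σ) ≤ a := fun i => Nat.zero_le _
  have := (hf.2.1 0 (zero_mem_lcmLattice M) a ha).1 h0a
  rw [ha0] at this
  exact le_antisymm this fun i => Nat.zero_le _

lemma map_mlcm_of_mapsTo (hf : IsEquivalence M M' f) (hM : ∀ m ∈ M, f m ∈ M')
    {S : Finset (Mon σ)} (hS : S ⊆ M) : f (mlcm S) = mlcm (S.image f) := by
  have hSM : S.image f ⊆ M' := Finset.image_subset_iff.2 fun m hm => hM m (hS hm)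
  apply le_antisymm
  · obtain ⟨v, hv, hvS⟩ := hf.1.surjOn (mlcm_mem_lcmLattice hSM)
    rw [← hvS, ← hf.2.1 _ (mlcm_mem_lcmLattice hS) _ hv]
    refine Finset.sup_le fun m hm => ?_
    rw [id, hf.2.1 m (mem_lcmLattice_of_mem (hS hm)) v hv, hvS]
    exact Finset.le_sup (f := id) (Finset.mem_image_of_mem f hm)
  · refine Finset.sup_le fun y hy => ?_
    obtain ⟨m, hm, rfl⟩ := Finset.mem_image.1 hy
    exact (hf.2.1 m (mem_lcmLattice_of_mem (hS hm)) _ (mlcm_mem_lcmLattice hS)).1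
      (Finset.le_sup (f := id) hm)

/-- An equivalence maps minimal generators, the atoms of the lcm-lattice, to minimal
generators. -/
lemma map_mem (hf : IsEquivalence M M' f) (hmin : IsAntichain' M) (h0 : 0 ∉ M)
    (h0' : 0 ∉ M') {m : Mon σ} (hm : m ∈ M) : f m ∈ M' := by
  have hmL := mem_lcmLattice_of_mem hm
  have hfm : f m ≠ 0 := fun h => h0
    (hf.1.injOn hmL (zero_mem_lcmLattice M) (h.trans hf.map_zero.symm) ▸ hm)
  obtain ⟨u, hu, hum⟩ := exists_mem_le_of_ne_zero (hf.1.mapsTo hmL) hfm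
  obtain ⟨v, hv, rfl⟩ := hf.1.surjOn (mem_lcmLattice_of_mem hu)
  have hv0 : v ≠ 0 := by
    rintro rfl
    exact h0' (hf.map_zero ▸ hu)
  have hvm : v ≤ m := (hf.2.1 v hv m hmL).2 hum
  obtain ⟨w, hw, hwv⟩ := exists_mem_le_of_ne_zero hv hv0
  have hwm : w = m := hmin w hw m hm (hwv.trans hvm)
  rwa [← le_antisymm hvm (hwm ▸ hwv)]

lemma image_eq (hf : IsEquivalence M M' f) (hmin : IsAntichain' M) (hmin' : IsAntichain' M')
    (h0 : 0 ∉ M) (h0' : 0 ∉ M') : M.image f = M' := by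
  refine Finset.Subset.antisymm
    (Finset.image_subset_iff.2 fun m hm => hf.map_mem hmin h0 h0' hm) fun u hu => ?_
  exact Finset.mem_image.2 ⟨_, hf.symm.map_mem hmin' h0' h0 hu,
    hf.1.invOn_invFunOn.2 (mem_lcmLattice_of_mem hu)⟩

lemma preservesLcm (hf : IsEquivalence M M' f) (hM : ∀ m ∈ M, f m ∈ M') : PreservesLcm M f where
  injOn := hf.1.injOn.mono fun _ hm => mem_lcmLattice_of_mem hm
  adj a ha b hb := hf.2.2 a (mem_lcmLattice_of_mem ha) b (mem_lcmLattice_of_mem hb)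
  mlcm_le S hS T hT := by
    rw [hf.2.1 _ (mlcm_mem_lcmLattice hS) _ (mlcm_mem_lcmLattice hT),
      hf.map_mlcm_of_mapsTo hM hS, hf.map_mlcm_of_mapsTo hM hT]

end IsEquivalence

/-! ### Applying a map to the coefficients -/

/-- `applyEquiv f` as an additive homomorphism. -/
def applyEquivHom {t t' : ℕ} (f : Mon (Fin t) → Mon (Fin t')) :
    MvPolynomial (Option (Fin t)) ℤ →+ MvPolynomial (Option (Fin t')) ℤ where
  toFun := applyEquiv f
  map_zero' := by simp [applyEquiv]
  map_add' a b := Finsupp.sum_add_index' (fun _ => _root_.map_zero _) fun _ => _root_.map_add _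

lemma applyEquiv_monomial {t t' : ℕ} (f : Mon (Fin t) → Mon (Fin t')) (α : Mon (Fin t)) (d : ℕ)
    (c : ℤ) : applyEquiv f (MvPolynomial.monomial (expOf α d) c) =
      MvPolynomial.monomial (expOf (f α) d) c :=
  Finsupp.sum_single_index (_root_.map_zero _)

lemma expOf_zero (t : ℕ) : expOf (0 : Mon (Fin t)) 0 = 0 := by
  ext o
  cases o <;> rfl

lemma zero_notMem_of_two_le_mdeg {t : ℕ} {M : Finset (Mon (Fin t))}
    (hM : ∀ m ∈ M, 2 ≤ mdeg m) : 0 ∉ M := fun h => by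
  simpa [mdeg] using hM 0 h

end MonomialRings

open MonomialRings

/-- **Lemma (invariance of `F` under equivalence).**
For a monomial set `M` of monomials of degree at least 2 put
`F(M) = 1 + ∑_{S ∈ sat(M)} m_S (-z)^{c(S)+2} H̃(Δ'_S;k)(z)`, and `F(I) = F(M_I)` for a
monomial ideal `I`.  If `I`, `I'` are equivalent monomial ideals with minimal generating
sets `M`, `M'` and `f : L_I → L_{I'}` is an equivalence, then `f(F(I)) = F(I')`. -/
theorem F_invariant_under_equivalence
    (t t' : ℕ) (k : Type) [Field k]
    (M : Finset (Mon (Fin t))) (M' : Finset (Mon (Fin t')))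
    (hmin : IsAntichain' M) (hmin' : IsAntichain' M')
    (hdeg : ∀ m ∈ M, 2 ≤ mdeg m) (hdeg' : ∀ m ∈ M', 2 ≤ mdeg m)
    (f : Mon (Fin t) → Mon (Fin t'))
    (hf : IsEquivalence M M' f) :
    applyEquiv f (bFormula k M) = bFormula k M' := by
  have h0 := zero_notMem_of_two_le_mdeg hdeg
  have h0' := zero_notMem_of_two_le_mdeg hdeg'
  have hM : ∀ m ∈ M, f m ∈ M' := fun m hm => hf.map_mem hmin h0 h0' hm
  have hp := hf.preservesLcm hM
  have hone : applyEquiv f 1 = 1 := by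
    have := applyEquiv_monomial f 0 0 1
    rwa [hf.map_zero, expOf_zero, expOf_zero] at this
  rw [← hf.image_eq hmin hmin' h0 h0']
  change applyEquivHom f (bFormula k M) = _
  rw [bFormula, bFormula, map_add, map_sum, hp.sum_satSets_image]
  refine congrArg₂ (· + ·) hone (Finset.sum_congr rfl fun S hS => ?_)
  have hSM : S ⊆ M := Finset.mem_powerset.1 (Finset.mem_filter.1 hS).1
  have hpS := hp.mono hSM
  rw [map_sum, hpS.card_image]
  refine Finset.sum_congr rfl fun n _ => ?_
  rw [hpS.ncomp_image, hpS.hdim_dprime_image, ← hf.map_mlcm_of_mapsTo hM hSM]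
  exact applyEquiv_monomial _ _ _ _
end
end

section
/- Let k be a field and let Δ_1, …, Δ_r be simplicial complexes on pairwise disjoint finite vertex sets. If Δ = Δ_1 · … · Δ_r is their iterated dual join, then the generating functions of reduced homology satisfy H̃(Δ;k)(z) = z^{2r−2} · H̃(Δ_1;k)(z) · … · H̃(Δ_r;k)(z). -/
noncomputable section
attribute [local instance] Classical.propDecidable
namespace MonomialRings

/-- The iterated dual join `Δ₁ · … · Δ_r` of simplicial complexes on pairwise disjoint
vertex sets `V i`: its faces are the `F ⊆ V 1 ∪ … ∪ V r` with `F ∩ V i ∈ Δ i` for some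
`i`. -/
def dualJoin {V : Type*} {r : ℕ} (Vs : Fin r → Finset V) (Δs : Fin r → Set (Finset V)) :
    Set (Finset V) :=
  {F | (F : Set V) ⊆ (⋃ i, (Vs i : Set V)) ∧ ∃ i, F ∩ Vs i ∈ Δs i}

end MonomialRings

open MonomialRings

namespace MonomialRings

open Matrix Kronecker

/-- The complex with graded basis `S` and differential `D` contracts, through degree-preserving
matrices `I` and `J` and a homotopy `h`, onto the graded vector space with basis `H` and zero
differential. -/
def ContractsTo {k : Type*} [Field k] {S H : Type*} [Fintype S] [Fintype H]
    (g : S → ℤ) (D : Matrix S S k) (gH : H → ℤ) : Prop :=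
  ∃ (I : Matrix S H k) (J : Matrix H S k) (h : Matrix S S k),
    D * I = 0 ∧ J * D = 0 ∧ J * I = 1 ∧ I * J + (D * h + h * D) = 1 ∧
    (∀ s x, I s x ≠ 0 → g s = gH x) ∧ (∀ x s, J x s ≠ 0 → gH x = g s)

section Contraction

variable {k : Type*} [Field k] {S T H H' : Type*} [Fintype S] [Fintype T] [Fintype H] [Fintype H']

theorem eq_of_mul_apply_ne_zero {R Q : Type*} {gR : R → ℤ} {gS : S → ℤ} {gQ : Q → ℤ} {a b : ℤ}
    {A : Matrix R S k} {B : Matrix S Q k}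
    (hA : ∀ s t, A s t ≠ 0 → gR s = gS t + a) (hB : ∀ s t, B s t ≠ 0 → gS s = gQ t + b)
    (s : R) (t : Q) (h : (A * B) s t ≠ 0) : gR s = gQ t + (a + b) := by
  rw [Matrix.mul_apply] at h
  obtain ⟨u, -, hu⟩ := Finset.exists_ne_zero_of_sum_ne_zero h
  have h1 := hA s u (left_ne_zero_of_mul hu)
  have h2 := hB u t (right_ne_zero_of_mul hu)
  omega

/-- Every matrix over a field has a generalized inverse. -/
theorem exists_mul_mul_eq (D : Matrix S S k) : ∃ h : Matrix S S k, D * h * D = D := by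
  obtain ⟨f, hf⟩ := (Matrix.toLin' D).rangeRestrict.exists_rightInverse_of_surjective
    (LinearMap.range_rangeRestrict _)
  obtain ⟨F, hF⟩ := LinearMap.exists_extend f
  refine ⟨LinearMap.toMatrix' F, ?_⟩
  apply Matrix.toLin'.injective
  rw [Matrix.toLin'_mul, Matrix.toLin'_mul, Matrix.toLin'_toMatrix']
  ext1 s
  ext1 
  have h1 : ∀ x, F (Matrix.toLin' D x) = f ((Matrix.toLin' D).rangeRestrict x) := fun x => by
    rw [← hF]; rfl
  have h2 : ∀ x, Matrix.toLin' D (F (Matrix.toLin' D x)) = Matrix.toLin' D x := fun x => by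
    rw [h1]
    exact congrArg Subtype.val (LinearMap.congr_fun hf ((Matrix.toLin' D).rangeRestrict x))
  exact h2 _

/-- Every matrix of square zero and degree `-1` has a generalized inverse of square zero
and degree `1`. -/
theorem exists_graded_inverse (g : S → ℤ) (D : Matrix S S k) (hD : D * D = 0)
    (hg : ∀ s t, D s t ≠ 0 → g s = g t + (-1)) :
    ∃ h : Matrix S S k, D * h * D = D ∧ h * h = 0 ∧ ∀ s t, h s t ≠ 0 → g s = g t + 1 := by
  obtain ⟨h₀, hh₀⟩ := exists_mul_mul_eq D
  let h₁ : Matrix S S k := Matrix.of fun s t => if g s = g t + 1 then h₀ s t else 0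
  have hg₁ : ∀ s t, h₁ s t ≠ 0 → g s = g t + 1 := fun s t h => by
    by_contra hn
    exact h (if_neg hn)
  have hDh₁ : D * h₁ * D = D := by
    ext s t
    by_cases hst : g s = g t + (-1)
    · conv_rhs => rw [← hh₀]
      simp only [Matrix.mul_apply]
      refine Finset.sum_congr rfl fun v _ => ?_
      by_cases hv : D v t = 0
      · simp [hv]
      congr 1
      refine Finset.sum_congr rfl fun u _ => ?_
      by_cases hu : D s u = 0
      · simp [hu]
      have := hg _ _ hv
      have := hg _ _ hu
      have : g u = g v + 1 := by omega
      simp [h₁, this]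
    · have h1 : D s t = 0 := by
        by_contra h
        exact hst (hg s t h)
      rw [h1]
      by_contra h
      have := eq_of_mul_apply_ne_zero (eq_of_mul_apply_ne_zero hg hg₁) hg s t h
      omega
  have hidem : D * h₁ * (D * h₁) = D * h₁ := by rw [← mul_assoc, hDh₁]
  refine ⟨h₁ * (D * h₁) - D * h₁ * h₁ * (D * h₁), ?_, ?_, ?_⟩
  · have e1 : D * (h₁ * (D * h₁)) * D = D := by
      calc _ = (D * h₁ * D) * h₁ * D := by simp only [mul_assoc]
        _ = D := by rw [hDh₁, hDh₁]
    have e2 : D * (D * h₁ * h₁ * (D * h₁)) = 0 := by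
      calc _ = (D * D) * (h₁ * h₁ * (D * h₁)) := by simp only [mul_assoc]
        _ = 0 := by rw [hD, zero_mul]
    rw [mul_sub, e2, sub_zero, e1]
  · have e : D * h₁ * (h₁ * (D * h₁) - D * h₁ * h₁ * (D * h₁)) = 0 := by
      calc _ = D * h₁ * h₁ * (D * h₁) - (D * h₁ * (D * h₁)) * h₁ * (D * h₁) := by
            simp only [mul_sub, mul_assoc]
        _ = 0 := by rw [hidem, sub_self]
    calc _ = (h₁ - D * h₁ * h₁) * (D * h₁ * (h₁ * (D * h₁) - D * h₁ * h₁ * (D * h₁))) := by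
          simp only [sub_mul, mul_assoc]
      _ = 0 := by rw [e, mul_zero]
  · intro s t hst
    have hDh := eq_of_mul_apply_ne_zero hg hg₁
    by_cases h1 : (h₁ * (D * h₁)) s t = 0
    · have h2 : (D * h₁ * h₁ * (D * h₁)) s t ≠ 0 := fun h2 => hst (by
        rw [Matrix.sub_apply, h1, h2, sub_zero])
      have := eq_of_mul_apply_ne_zero (eq_of_mul_apply_ne_zero hDh hg₁) hDh s t h2
      omega
    · have := eq_of_mul_apply_ne_zero hg₁ hDh s t h1
      omega

theorem mul_eq_one_of_injective {R : Type*} {I : Matrix R H k} {J : Matrix H R k} [Fintype R]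
    (hI : ∀ A : Matrix H H k, I * A = 0 → A = 0) (h : I * (J * I) = I) : J * I = 1 := by
  rw [← sub_eq_zero]
  apply hI
  rw [Matrix.mul_sub, h, Matrix.mul_one, sub_self]

theorem mul_mul_cancel_left {R Q : Type*} [Fintype Q] {E : Matrix S Q k} {E' : Matrix Q S k}
    (h : E * E' = 1) (A : Matrix S R k) : E * (E' * A) = A := by
  rw [← Matrix.mul_assoc, h, Matrix.one_mul]

/-- Over a field every finite complex contracts onto its homology. -/
theorem exists_contractsTo (g : S → ℤ) (D : Matrix S S k) (hD : D * D = 0)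
    (hg : ∀ s t, D s t ≠ 0 → g s = g t + (-1)) :
    ∃ (p : Set S), ContractsTo g D (fun x : p => g x) := by
  obtain ⟨h, hDh, hh, hgh⟩ := exists_graded_inverse g D hD hg
  let q : Matrix S S k := 1 - D * h - h * D
  have hDq : D * q = 0 := by
    calc D * q = D - (D * D) * h - D * h * D := by simp only [q, mul_sub, mul_assoc, mul_one]
      _ = 0 := by rw [hD, hDh]; simp
  have hqD : q * D = 0 := by
    calc q * D = D - D * h * D - h * (D * D) := by simp only [q, sub_mul, mul_assoc, one_mul]
      _ = 0 := by rw [hD, hDh]; simp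
  have hqh : q * h * D = 0 := by
    calc q * h * D = h * D - D * (h * h) * D - h * (D * h * D) := by
          simp only [q, sub_mul, mul_assoc, one_mul]
      _ = 0 := by rw [hh, hDh]; simp
  have hqq : q * q = q := by
    calc q * q = q - (q * D) * h - q * h * D := by
          conv_lhs => rw [show q * q = q * (1 - D * h - h * D) from rfl]
          simp only [mul_sub, mul_assoc, mul_one]
      _ = q := by rw [hqD, hqh]; simp
  have hgq : ∀ s t, q s t ≠ 0 → g s = g t := by
    intro s t hst
    by_contra hne
    have h1 : (1 : Matrix S S k) s t = 0 := Matrix.one_apply_ne fun h => hne (by rw [h])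
    have h2 : (D * h) s t = 0 := by
      by_contra h2
      have := eq_of_mul_apply_ne_zero hg hgh s t h2
      omega
    have h3 : (h * D) s t = 0 := by
      by_contra h3
      have := eq_of_mul_apply_ne_zero hgh hg s t h3
      omega
    apply hst
    simp [q, h1, h2, h3]
  obtain ⟨p, -, -, hspan, hli⟩ := exists_linearIndepOn_extension (K := k) (v := q.col)
    (s := ∅) (t := Set.univ) (linearIndepOn_empty _ _) (Set.empty_subset _)
  let I : Matrix S p k := Matrix.of fun s x => q s x
  have hinj : ∀ {R : Type _} (A : Matrix p R k), I * A = 0 → A = 0 := by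
    intro R A hA
    ext x r
    refine Fintype.linearIndependent_iff.1 hli (fun x => A x r) ?_ x
    ext s
    simpa [Matrix.mul_apply, mul_comm, I] using congrFun (congrFun hA s) r
  have hc : ∀ s, ∃ c : p → k, ∑ x, c x • q.col x = q.col s := fun s => by
    have := hspan ⟨s, Set.mem_univ s, rfl⟩
    rw [Set.image_eq_range] at this
    exact (Submodule.mem_span_range_iff_exists_fun k).1 this
  choose c hc using hc
  let J : Matrix p S k := Matrix.of fun x s => if g x = g s then c s x else 0
  have hIJ : I * J = q := by
    ext t s
    by_cases hts : g t = g s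
    · refine Eq.trans ?_ (congrFun (hc s) t)
      simp only [Matrix.mul_apply, Finset.sum_apply, Pi.smul_apply, smul_eq_mul]
      refine Finset.sum_congr rfl fun x _ => ?_
      by_cases hx : q t x = 0
      · simp [I, hx]
      · simp [I, J, (hgq _ _ hx).symm.trans hts, mul_comm]
    · rw [not_imp_comm.1 (hgq t s) hts]
      refine Finset.sum_eq_zero fun x _ => ?_
      by_cases hx : q t x = 0
      · simp [I, hx]
      · have : ¬ g x = g s := fun h => hts ((hgq _ _ hx).trans h)
        simp [J, this]
  have hI : ∀ (A : Matrix S S k) (s : S) (x : p), (A * I) s x = (A * q) s x :=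
    fun A s x => rfl
  refine ⟨p, I, J, h, ?_, ?_, ?_, ?_, ?_, ?_⟩
  · ext s x
    rw [hI, hDq]
    rfl
  · apply hinj
    rw [← Matrix.mul_assoc, hIJ, hqD]
  · refine mul_eq_one_of_injective (fun A => hinj A) ?_
    rw [← Matrix.mul_assoc, hIJ]
    ext s x
    rw [hI, hqq]
    rfl
  · rw [hIJ]
    simp only [q]
    abel
  · exact fun s x h => hgq s x h
  · intro x s h
    by_contra hn
    exact h (if_neg hn)

theorem ContractsTo.card_le {g : S → ℤ} {D : Matrix S S k} {gH : H → ℤ} {gH' : H' → ℤ}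
    (h₁ : ContractsTo g D gH) (h₂ : ContractsTo g D gH') (n : ℤ) :
    Fintype.card {x // gH x = n} ≤ Fintype.card {y // gH' y = n} := by
  obtain ⟨I, J, -, hDI, hJD, hJI, -, hgI, hgJ⟩ := h₁
  obtain ⟨I', J', h', -, -, -, hIJ', hgI', hgJ'⟩ := h₂
  have hone : (J * I') * (J' * I) = 1 := by
    have : I' * J' = 1 - D * h' - h' * D := by rw [← hIJ']; abel
    calc _ = J * (I' * J') * I := by simp only [Matrix.mul_assoc]
      _ = J * I - (J * D) * h' * I - J * h' * (D * I) := by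
        rw [this]
        simp only [Matrix.mul_sub, Matrix.sub_mul, Matrix.mul_assoc, Matrix.mul_one]
      _ = 1 := by rw [hJI, hJD, hDI]; simp
  have hdeg : ∀ x y, (J * I') x y ≠ 0 → gH' y = gH x := fun x y h => by
    obtain ⟨s, -, hs⟩ := Finset.exists_ne_zero_of_sum_ne_zero h
    rw [hgJ _ _ (left_ne_zero_of_mul hs), hgI' _ _ (right_ne_zero_of_mul hs)]
  let A : Matrix {x // gH x = n} {y // gH' y = n} k := (J * I').submatrix (↑) (↑)
  let B : Matrix {y // gH' y = n} {x // gH x = n} k := (J' * I).submatrix (↑) (↑)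
  have hAB : A * B = 1 := by
    ext x x'
    have h1 : (A * B) x x' = ((J * I') * (J' * I)) x x' := by
      rw [Matrix.mul_apply, Matrix.mul_apply]
      refine (Finset.sum_subtype (Finset.univ.filter fun y => gH' y = n) (by simp)
        (fun y => (J * I') x y * (J' * I) y x')).symm.trans ?_
      refine Finset.sum_subset (Finset.subset_univ _) fun y _ hy => ?_
      by_cases hxy : (J * I') x y = 0
      · rw [hxy, zero_mul]
      · exact absurd (by simpa using (hdeg _ _ hxy).trans x.2) hy
    rw [h1, hone]
    simp [Matrix.one_apply, Subtype.ext_iff]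
  calc Fintype.card {x // gH x = n} = (A * B).rank := by rw [hAB, Matrix.rank_one]
    _ ≤ A.rank := Matrix.rank_mul_le_left A B
    _ ≤ _ := Matrix.rank_le_card_width A

/-- The graded vector space onto which a complex contracts is unique. -/
theorem ContractsTo.card_eq {g : S → ℤ} {D : Matrix S S k} {gH : H → ℤ} {gH' : H' → ℤ}
    (h₁ : ContractsTo g D gH) (h₂ : ContractsTo g D gH') (n : ℤ) :
    Fintype.card {x // gH x = n} = Fintype.card {y // gH' y = n} :=
  le_antisymm (h₁.card_le h₂ n) (h₂.card_le h₁ n)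

/-- The tensor product of two contractions. -/
theorem ContractsTo.kronecker {g : S → ℤ} {D : Matrix S S k} {gH : H → ℤ}
    {g' : T → ℤ} {D' : Matrix T T k} {gH' : H' → ℤ} (σ : Matrix S S k) (hσ : σ * σ = 1)
    (hσD : D * σ + σ * D = 0)
    (h₁ : ContractsTo g D gH) (h₂ : ContractsTo g' D' gH') :
    ContractsTo (fun x : S × T => g x.1 + g' x.2) (D ⊗ₖ (1 : Matrix T T k) + σ ⊗ₖ D')
      (fun x : H × H' => gH x.1 + gH' x.2) := by
  obtain ⟨I, J, h, hDI, hJD, hJI, hIJ, hgI, hgJ⟩ := h₁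
  obtain ⟨I', J', h', hDI', hJD', hJI', hIJ', hgI', hgJ'⟩ := h₂
  refine ⟨I ⊗ₖ I', J ⊗ₖ J', h ⊗ₖ (I' * J') + σ ⊗ₖ h', ?_, ?_, ?_, ?_, ?_, ?_⟩
  · rw [Matrix.add_mul, ← Matrix.mul_kronecker_mul, ← Matrix.mul_kronecker_mul, hDI, hDI']
    simp
  · rw [Matrix.mul_add, ← Matrix.mul_kronecker_mul, ← Matrix.mul_kronecker_mul, hJD, hJD']
    simp
  · rw [← Matrix.mul_kronecker_mul, hJI, hJI']
    have e : (1 : Matrix H H k) ⊗ₖ (1 : Matrix H' H' k) = 1 := Matrix.one_kronecker_one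
    convert e using 1
    ext x y
    simp only [Matrix.one_apply]
    split_ifs <;> rfl
  · have hP : D' * (I' * J') = 0 := by rw [← Matrix.mul_assoc, hDI', Matrix.zero_mul]
    have hP' : I' * J' * D' = 0 := by rw [Matrix.mul_assoc, hJD', Matrix.mul_zero]
    simp only [Matrix.add_mul, Matrix.mul_add, ← Matrix.mul_kronecker_mul, hP, hP', hσ,
      Matrix.one_mul, Matrix.mul_one, Matrix.kronecker_zero, add_zero]
    have e1 : (D * σ) ⊗ₖ h' + (σ * D) ⊗ₖ h' = 0 := by
      rw [← Matrix.add_kronecker, hσD, Matrix.zero_kronecker]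
    have e2 : (I * J) ⊗ₖ (I' * J') +
        ((D * h) ⊗ₖ (I' * J') + (h * D) ⊗ₖ (I' * J') +
          ((1 : Matrix S S k) ⊗ₖ (D' * h') + (1 : Matrix S S k) ⊗ₖ (h' * D'))) =
        (1 : Matrix S S k) ⊗ₖ (1 : Matrix T T k) := by
      rw [← Matrix.add_kronecker, ← Matrix.kronecker_add, ← add_assoc, ← Matrix.add_kronecker,
        hIJ, ← Matrix.kronecker_add, hIJ']
    have e3 : (1 : Matrix S S k) ⊗ₖ (1 : Matrix T T k) = 1 := Matrix.one_kronecker_one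
    convert e2.trans e3 using 1
    · rw [← sub_eq_zero]
      refine Eq.trans ?_ e1
      abel
    · ext x y
      simp only [Matrix.one_apply]
      split_ifs <;> rfl
  · rintro ⟨s, t⟩ ⟨x, y⟩ hst
    exact congrArg₂ _ (hgI _ _ (left_ne_zero_of_mul hst)) (hgI' _ _ (right_ne_zero_of_mul hst))
  · rintro ⟨x, y⟩ ⟨s, t⟩ hst
    exact congrArg₂ _ (hgJ _ _ (left_ne_zero_of_mul hst)) (hgJ' _ _ (right_ne_zero_of_mul hst))

/-- Transport of a contraction along a bijection of bases and a change of signs. -/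
theorem ContractsTo.rescale {g : S → ℤ} {D : Matrix S S k} {gH : H → ℤ}
    {g' : T → ℤ} {D' : Matrix T T k} (e : T ≃ S) (ε : T → k) (hε : ∀ t, ε t * ε t = 1)
    (hg : ∀ t, g' t = g (e t)) (hD : ∀ s t, D' s t = ε s * D (e s) (e t) * ε t)
    (h₁ : ContractsTo g D gH) : ContractsTo g' D' gH := by
  obtain ⟨I, J, h, hDI, hJD, hJI, hIJ, hgI, hgJ⟩ := h₁
  let E : Matrix T S k := Matrix.of fun t s => if e t = s then ε t else 0
  let E' : Matrix S T k := E.transpose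
  have hEE' : E * E' = 1 := by
    ext s t
    by_cases hst : s = t
    · subst hst; simp [E, E', Matrix.mul_apply, hε]
    · simp [E, E', Matrix.mul_apply, hst]
  have hE'E : E' * E = 1 := by
    ext s t
    obtain ⟨s, rfl⟩ := e.surjective s
    obtain ⟨t, rfl⟩ := e.surjective t
    by_cases hst : s = t
    · subst hst; simp [E, E', Matrix.mul_apply, hε]
    · simp [E, E', Matrix.mul_apply, hst]
      exact fun h => absurd h.symm hst
  have hD' : D' = E * D * E' := by
    ext s t
    simp [E, E', Matrix.mul_apply, hD]
  refine ⟨E * I, J * E', E * h * E', ?_, ?_, ?_, ?_, ?_, ?_⟩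
  · simp only [hD', Matrix.mul_assoc, mul_mul_cancel_left hE'E, hDI, Matrix.mul_zero]
  · simp only [hD', Matrix.mul_assoc, mul_mul_cancel_left hE'E]
    rw [← Matrix.mul_assoc, hJD, Matrix.zero_mul]
  · simp only [Matrix.mul_assoc, mul_mul_cancel_left hE'E, hJI]
  · calc _ = E * (I * J + (D * h + h * D)) * E' := by
          simp only [hD', Matrix.mul_add, Matrix.add_mul, Matrix.mul_assoc,
            mul_mul_cancel_left hE'E]
      _ = 1 := by rw [hIJ, Matrix.mul_one, hEE']
  · intro t x htx
    rw [hg]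
    apply hgI
    intro h0
    exact htx (by simp [E, Matrix.mul_apply, h0])
  · intro x t htx
    rw [hg]
    apply hgJ
    intro h0
    exact htx (by simp [E, E', Matrix.mul_apply, h0])

/-- If a complex with basis `S ⊕ T`, in which `S` spans a subcomplex, is contractible, then
the quotient complex is the suspension of the subcomplex. -/
theorem ContractsTo.connecting {g : S → ℤ} {g' : T → ℤ} {gH : H → ℤ}
    {D : Matrix S S k} {X : Matrix S T k} {D' : Matrix T T k}
    {a : Matrix S S k} {c : Matrix T S k} {d : Matrix T T k}
    (hX : D * X + X * D' = 0) (h₁₁ : D * a + X * c + a * D = 1)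
    (h₂₁ : D' * c + c * D = 0) (h₂₂ : D' * d + c * X + d * D' = 1)
    (hgX : ∀ s t, X s t ≠ 0 → g' t = g s + 1) (hgc : ∀ t s, c t s ≠ 0 → g' t = g s + 1)
    (h : ContractsTo g D gH) : ContractsTo g' D' (fun x => gH x + 1) := by
  obtain ⟨I, J, h, hDI, hJD, hJI, hIJ, hgI, hgJ⟩ := h
  have hX' : X * D' = - (D * X) := by rw [eq_neg_iff_add_eq_zero, add_comm, hX]
  have hc' : c * D = - (D' * c) := by rw [eq_neg_iff_add_eq_zero, add_comm, h₂₁]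
  refine ⟨c * I, J * X, d - c * h * X, ?_, ?_, ?_, ?_, ?_, ?_⟩
  · rw [← Matrix.mul_assoc, ← neg_eq_iff_eq_neg.2 hc', Matrix.neg_mul, Matrix.mul_assoc, hDI]
    simp
  · rw [Matrix.mul_assoc, hX', Matrix.mul_neg, ← Matrix.mul_assoc, hJD]
    simp
  · have : X * c = 1 - D * a - a * D := by rw [← h₁₁]; abel
    calc J * X * (c * I) = J * (X * c) * I := by simp only [Matrix.mul_assoc]
      _ = J * I - (J * D) * a * I - J * a * (D * I) := by
        rw [this]
        simp only [Matrix.mul_sub, Matrix.sub_mul, Matrix.mul_assoc, Matrix.mul_one]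
      _ = 1 := by rw [hJI, hJD, hDI]; simp
  · have hIJ' : I * J = 1 - (D * h + h * D) := by rw [← hIJ]; abel
    have e1 : c * I * (J * X) = c * X - (c * D) * (h * X) - c * h * (D * X) := by
      calc _ = c * (I * J) * X := by simp only [Matrix.mul_assoc]
        _ = _ := by
          rw [hIJ']
          simp only [Matrix.mul_sub, Matrix.sub_mul, Matrix.mul_add, Matrix.add_mul,
            Matrix.mul_assoc, Matrix.mul_one, sub_sub]
    have e2 : D * X = - (X * D') := by rw [eq_neg_iff_add_eq_zero, hX]
    rw [e1, hc', e2, ← h₂₂]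
    simp only [Matrix.mul_sub, Matrix.sub_mul, Matrix.neg_mul, Matrix.mul_neg, Matrix.mul_assoc]
    abel
  · intro t x htx
    obtain ⟨s, -, hs⟩ := Finset.exists_ne_zero_of_sum_ne_zero htx
    rw [hgc _ _ (left_ne_zero_of_mul hs), hgI _ _ (right_ne_zero_of_mul hs)]
  · intro x t hxt
    obtain ⟨s, -, hs⟩ := Finset.exists_ne_zero_of_sum_ne_zero hxt
    have h1 : gH x = g s := hgJ _ _ (left_ne_zero_of_mul hs)
    rw [hgX _ _ (right_ne_zero_of_mul hs), ← h1]

theorem ContractsTo.exists_grade_eq {g : S → ℤ} {D : Matrix S S k} {gH : H → ℤ}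
    (h : ContractsTo g D gH) (x : H) : ∃ s, g s = gH x := by
  obtain ⟨I, J, -, -, -, hJI, -, hgI, -⟩ := h
  have h1 : (J * I) x x ≠ 0 := by simp [hJI]
  obtain ⟨s, -, hs⟩ := Finset.exists_ne_zero_of_sum_ne_zero h1
  exact ⟨s, hgI _ _ (right_ne_zero_of_mul hs)⟩

/-- The vectors of degree `n`. -/
def gradedPart (k : Type*) [Field k] {S : Type*} (g : S → ℤ) (n : ℤ) : Submodule k (S → k) where
  carrier := {w | ∀ s, w s ≠ 0 → g s = n}
  add_mem' {v w} hv hw s h := by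
    by_cases h1 : v s = 0
    · exact hw s fun h2 => h (by simp [h1, h2])
    · exact hv s h1
  zero_mem' s h := absurd rfl h
  smul_mem' c w hw s h := hw s (right_ne_zero_of_mul h)

/-- The number of generators of degree `n` of a contraction is the dimension of the homology. -/
theorem ContractsTo.finrank_eq {g : S → ℤ} {D : Matrix S S k} {gH : H → ℤ} (hD : D * D = 0)
    (hg : ∀ s t, D s t ≠ 0 → g s = g t + (-1)) (h : ContractsTo g D gH) (n : ℤ) :
    Module.finrank k ↥(gradedPart k g n ⊓ LinearMap.ker D.mulVecLin) =
      Module.finrank k ↥((gradedPart k g (n + 1)).map D.mulVecLin) +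
        Fintype.card {x // gH x = n} := by
  obtain ⟨I, J, h, hDI, hJD, hJI, hIJ, hgI, hgJ⟩ := h
  let Jn : Matrix {x // gH x = n} S k := J.submatrix (↑) id
  let Z := gradedPart k g n ⊓ LinearMap.ker D.mulVecLin
  let ψ : ↥Z →ₗ[k] ({x // gH x = n} → k) := Jn.mulVecLin ∘ₗ Z.subtype
  have hψ : ∀ z x, ψ z x = (J *ᵥ z.1) x := fun z x => rfl
  have hrange : LinearMap.range ψ = ⊤ := by
    rw [LinearMap.range_eq_top]
    intro u
    let u' : H → k := fun x => if hx : gH x = n then u ⟨x, hx⟩ else 0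
    refine ⟨⟨I *ᵥ u', ?_, ?_⟩, ?_⟩
    · intro s hs
      obtain ⟨x, -, hx⟩ := Finset.exists_ne_zero_of_sum_ne_zero hs
      rw [hgI _ _ (left_ne_zero_of_mul hx)]
      by_contra hn
      exact right_ne_zero_of_mul hx (dif_neg hn)
    · simp [hDI]
    · ext x
      rw [hψ, Matrix.mulVec_mulVec, hJI, Matrix.one_mulVec]
      simp [u', x.2]
  have hker : (LinearMap.ker ψ).map Z.subtype = (gradedPart k g (n + 1)).map D.mulVecLin := by
    ext z
    simp only [Submodule.mem_map, LinearMap.mem_ker, Matrix.mulVecLin_apply]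
    constructor
    · rintro ⟨⟨z, hz, hDz⟩, hJz, rfl⟩
      have hDz : D *ᵥ z = 0 := hDz
      have hJz' : J *ᵥ z = 0 := by
        ext x
        by_cases hx : gH x = n
        · exact congrFun hJz ⟨x, hx⟩
        · refine Finset.sum_eq_zero fun s _ => ?_
          by_contra hs
          exact hx ((hgJ _ _ (left_ne_zero_of_mul hs)).trans (hz _ (right_ne_zero_of_mul hs)))
      have hz' : D *ᵥ (h *ᵥ z) = z := by
        conv_rhs => rw [← Matrix.one_mulVec z, ← hIJ]
        simp only [Matrix.add_mulVec, ← Matrix.mulVec_mulVec, hJz', hDz, Matrix.mulVec_zero,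
          zero_add, add_zero]
      refine ⟨fun t => if g t = n + 1 then (h *ᵥ z) t else 0, ?_, ?_⟩
      · intro s hs
        by_contra hn
        exact hs (if_neg hn)
      · ext s
        by_cases hs : g s = n
        · refine Eq.trans ?_ (congrFun hz' s)
          refine Finset.sum_congr rfl fun t _ => ?_
          by_cases hst : D s t = 0
          · simp [hst]
          · have := hg s t hst
            have : g t = n + 1 := by omega
            simp [this]
        · have hzs : z s = 0 := by
            by_contra h0
            exact hs (hz s h0)
          refine Eq.trans ?_ hzs.symm
          refine Finset.sum_eq_zero fun t _ => ?_
          by_cases hst : D s t = 0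
          · simp [hst]
          · have := hg s t hst
            have : ¬ g t = n + 1 := by omega
            simp [this]
    · rintro ⟨c, hc, rfl⟩
      refine ⟨⟨D *ᵥ c, ?_, ?_⟩, ?_, rfl⟩
      · intro s hs
        obtain ⟨t, -, ht⟩ := Finset.exists_ne_zero_of_sum_ne_zero hs
        have h1 := hg _ _ (left_ne_zero_of_mul ht)
        have h2 := hc _ (right_ne_zero_of_mul ht)
        omega
      · simp [hD]
      · ext x
        rw [hψ, Matrix.mulVec_mulVec, hJD]
        simp
  have h1 := LinearMap.finrank_range_add_finrank_ker ψ
  rw [hrange, finrank_top, Module.finrank_fintype_fun_eq_card] at h1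
  rw [← hker, LinearEquiv.finrank_eq (Submodule.equivMapOfInjective _ Z.injective_subtype
    (LinearMap.ker ψ)).symm, ← h1, add_comm]

theorem ContractsTo.sum_T_eq {g : S → ℤ} {D : Matrix S S k} {gH : H → ℤ} {gH' : H' → ℤ}
    (h₁ : ContractsTo g D gH) (h₂ : ContractsTo g D gH') :
    ∑ x, (LaurentPolynomial.T (gH x) : LaurentPolynomial ℤ) =
      ∑ y, LaurentPolynomial.T (gH' y) := by
  let e : H ≃ H' := (Equiv.sigmaFiberEquiv gH).symm.trans
    ((Equiv.sigmaCongrRight fun n => Fintype.equivOfCardEq (h₁.card_eq h₂ n)).trans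
      (Equiv.sigmaFiberEquiv gH'))
  refine Fintype.sum_equiv e _ _ fun x => ?_
  congr 1
  exact ((Fintype.equivOfCardEq (h₁.card_eq h₂ (gH x))) ⟨x, rfl⟩).2.symm

theorem sum_T_eq_sum_card {gH : H → ℤ} {b : ℕ} (hb : ∀ x, 0 ≤ gH x ∧ gH x ≤ b) :
    ∑ x, (LaurentPolynomial.T (gH x) : LaurentPolynomial ℤ) =
      ∑ n ∈ Finset.range (b + 1),
        (Fintype.card {x // gH x = n} : ℤ) • LaurentPolynomial.T (n : ℤ) := by
  rw [← Finset.sum_fiberwise_of_maps_to (t := Finset.range (b + 1)) (g := fun x => (gH x).toNat)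
    (fun x _ => Finset.mem_range.2 (by have := hb x; omega))]
  refine Finset.sum_congr rfl fun n _ => ?_
  have h1 : (Finset.univ.filter fun x => (gH x).toNat = n) =
      Finset.univ.filter fun x => gH x = n :=
    Finset.filter_congr fun x _ => by have := hb x; omega
  rw [h1, Finset.sum_congr rfl (g := fun _ => LaurentPolynomial.T (n : ℤ)) fun x hx => by
    rw [(Finset.mem_filter.1 hx).2], Finset.sum_const, Fintype.card_subtype, natCast_zsmul]

end Contraction

section Simplicial

variable (k : Type*) [Field k] {V : Type*}

/-- The sign of the inversion of two vertices. -/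
def inv (y x : V) : k := if (vOrd V).lt y x then -1 else 1

theorem inv_mul_self (y x : V) : inv k y x * inv k y x = 1 := by
  unfold inv
  split_ifs <;> simp

theorem inv_self (x : V) : inv k x x = 1 :=
  if_neg (letI := vOrd V; lt_irrefl x)

theorem inv_swap {x y : V} (h : x ≠ y) : inv k x y = - inv k y x := by
  let _ := vOrd V
  unfold inv
  rcases lt_or_gt_of_ne h with h | h
  · rw [if_pos h, if_neg (not_lt_of_gt h)]
  · rw [if_pos h, if_neg (not_lt_of_gt h), neg_neg]

/-- The sign of the vertex `x` with respect to the face `F`. -/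
def vsign (F : Finset V) (x : V) : k := ∏ y ∈ F, inv k y x

theorem neg_one_pow_rankIn_s13 (F : Finset V) (x : V) : (-1 : k) ^ rankIn F x = vsign k F x := by
  unfold vsign inv rankIn
  rw [Finset.prod_ite, Finset.prod_const, Finset.prod_const_one, mul_one]

theorem vsign_mul_self (F : Finset V) (x : V) : vsign k F x * vsign k F x = 1 := by
  unfold vsign
  rw [← Finset.prod_mul_distrib]
  exact Finset.prod_eq_one fun y _ => inv_mul_self k y x

variable {k}

theorem vsign_erase {F : Finset V} {x : V} (hx : x ∈ F) (y : V) :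
    vsign k (F.erase x) y = vsign k F y * inv k x y := by
  unfold vsign
  rw [← Finset.mul_prod_erase F _ hx, mul_right_comm, inv_mul_self, one_mul]

theorem vsign_insert {F : Finset V} {x : V} (hx : x ∉ F) (y : V) :
    vsign k (insert x F) y = inv k x y * vsign k F y :=
  Finset.prod_insert hx

theorem bdryAux_apply (F G : Finset V) :
    bdryAux k F G = ∑ x ∈ F, if F.erase x = G then vsign k F x else 0 := by
  unfold bdryAux
  rw [Finsupp.finsetSum_apply]
  refine Finset.sum_congr rfl fun x _ => ?_
  rw [Finsupp.smul_apply, Finsupp.single_apply, neg_one_pow_rankIn_s13]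
  simp

theorem exists_erase_eq {F G : Finset V} (h : bdryAux k F G ≠ 0) : ∃ x ∈ F, F.erase x = G := by
  rw [bdryAux_apply] at h
  obtain ⟨x, hx, h⟩ := Finset.exists_ne_zero_of_sum_ne_zero h
  exact ⟨x, hx, by_contra fun hn => h (if_neg hn)⟩

theorem card_eq_of_bdryAux_ne_zero {F G : Finset V} (h : bdryAux k F G ≠ 0) :
    (F.card : ℤ) = G.card + 1 := by
  obtain ⟨x, hx, rfl⟩ := exists_erase_eq h
  have := Finset.card_erase_add_one hx
  omega

theorem sum_bdryAux_mul {F : Finset V} {A : Finset (Finset V)} (hA : ∀ x ∈ F, F.erase x ∈ A)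
    (f : Finset V → k) :
    ∑ G ∈ A, f G * bdryAux k F G = ∑ x ∈ F, f (F.erase x) * vsign k F x := by
  simp only [bdryAux_apply, Finset.mul_sum]
  rw [Finset.sum_comm]
  refine Finset.sum_congr rfl fun x hx => ?_
  simp [hA x hx]

theorem bdryAux_bdryAux {F E : Finset V} {A : Finset (Finset V)} (hA : ∀ x ∈ F, F.erase x ∈ A) :
    ∑ G ∈ A, bdryAux k G E * bdryAux k F G = 0 := by
  rw [sum_bdryAux_mul hA fun G => bdryAux k G E]
  simp only [bdryAux_apply, Finset.sum_mul]
  rw [Finset.sum_sigma']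
  refine Finset.sum_involution (fun p _ => ⟨p.2, p.1⟩) ?_ ?_ ?_ ?_
  · rintro ⟨x, y⟩ hp
    simp only [Finset.mem_sigma, Finset.mem_erase] at hp
    simp only [vsign_erase hp.1, vsign_erase hp.2.2, inv_swap k hp.2.1, Finset.erase_right_comm (a := y)]
    split_ifs <;> ring
  · rintro ⟨x, y⟩ hp -
    simp only [Finset.mem_sigma, Finset.mem_erase] at hp
    intro h
    exact hp.2.1 (congrArg Sigma.fst h)
  · rintro ⟨x, y⟩ hp
    simp only [Finset.mem_sigma, Finset.mem_erase] at hp ⊢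
    exact ⟨hp.2.2, hp.2.1.symm, hp.1⟩
  · rintro ⟨x, y⟩ hp
    rfl

/-- The coefficients of the cone operator with apex `v`, a contracting homotopy of a simplex. -/
def coneAux (k : Type*) [Field k] {V : Type*} (v : V) (F G : Finset V) : k :=
  if v ∉ F ∧ insert v F = G then vsign k F v else 0

theorem card_eq_of_coneAux_ne_zero {v : V} {F G : Finset V} (h : coneAux k v F G ≠ 0) :
    (G.card : ℤ) = F.card + 1 := by
  have h1 : v ∉ F ∧ insert v F = G := by_contra fun hn => h (if_neg hn)
  rw [← h1.2, Finset.card_insert_of_notMem h1.1]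
  simp

theorem coneAux_homotopy {v : V} {W F E : Finset V} (hv : v ∈ W) (hF : F ⊆ W) :
    ∑ G ∈ W.powerset, bdryAux k G E * coneAux k v F G +
      ∑ G ∈ W.powerset, coneAux k v G E * bdryAux k F G = if E = F then 1 else 0 := by
  rw [sum_bdryAux_mul (fun x _ => Finset.mem_powerset.2 ((Finset.erase_subset _ _).trans hF))
    fun G => coneAux k v G E]
  by_cases hvF : v ∈ F
  · have h1 : ∑ G ∈ W.powerset, bdryAux k G E * coneAux k v F G = 0 :=
      Finset.sum_eq_zero fun G _ => by simp [coneAux, hvF]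
    rw [h1, zero_add, Finset.sum_eq_single_of_mem v hvF]
    · simp only [coneAux, Finset.notMem_erase, not_false_eq_true, true_and,
        Finset.insert_erase hvF, vsign_erase hvF, inv_self, mul_one, ite_mul, vsign_mul_self,
        zero_mul, eq_comm]
    · intro x hx hxv
      simp [coneAux, Ne.symm hxv, hvF]
  · have h1 : ∑ G ∈ W.powerset, bdryAux k G E * coneAux k v F G =
        bdryAux k (insert v F) E * vsign k F v := by
      rw [Finset.sum_eq_single_of_mem (insert v F)
        (Finset.mem_powerset.2 (Finset.insert_subset hv hF))]
      · simp [coneAux, hvF]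
      · intro G _ hG
        simp [coneAux, Ne.symm hG]
    rw [h1, bdryAux_apply, Finset.sum_insert hvF, Finset.erase_insert hvF, add_mul, add_assoc,
      Finset.sum_mul, ← Finset.sum_add_distrib, Finset.sum_eq_zero, add_zero,
      vsign_insert hvF, inv_self, one_mul]
    · rw [ite_mul, vsign_mul_self, zero_mul]
      simp only [eq_comm]
    · intro x hx
      have hxv : x ≠ v := fun h => hvF (h ▸ hx)
      have hvx : v ∉ F.erase x := fun h => hvF (Finset.mem_of_mem_erase h)
      simp only [coneAux, hvx, not_false_eq_true, true_and, vsign_insert hvF, vsign_erase hx,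
        Finset.erase_insert_of_ne hxv.symm, inv_swap k hxv]
      split_ifs <;> ring

/-- The boundary matrix between two families of faces. -/
def bdryMatrix (k : Type*) [Field k] {V : Type*} (A B : Finset (Finset V)) : Matrix A B k :=
  Matrix.of fun G F => bdryAux k F.1 G.1

/-- The cone matrix between two families of faces. -/
def coneMatrix (k : Type*) [Field k] {V : Type*} (v : V) (A B : Finset (Finset V)) :
    Matrix A B k :=
  Matrix.of fun G F => coneAux k v F.1 G.1

/-- The number of vertices of a face, as an integer. -/
def faceDeg (A : Finset (Finset V)) (F : A) : ℤ := F.1.card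

theorem faceDeg_of_bdryMatrix (A B : Finset (Finset V)) (G : A) (F : B)
    (h : bdryMatrix k A B G F ≠ 0) : faceDeg A G = faceDeg B F + (-1) := by
  have : (F.1.card : ℤ) = G.1.card + 1 := card_eq_of_bdryAux_ne_zero h
  simp only [faceDeg]
  omega

theorem bdryMatrix_mul_self {A : Finset (Finset V)} (hA : ∀ F ∈ A, ∀ G ⊆ F, G ∈ A) :
    bdryMatrix k A A * bdryMatrix k A A = 0 := by
  ext E F
  rw [Matrix.mul_apply]
  refine (Finset.sum_coe_sort A fun G => bdryAux k G E.1 * bdryAux k F.1 G).trans ?_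
  exact bdryAux_bdryAux fun x _ => hA _ F.2 _ (Finset.erase_subset _ _)

theorem sum_coe_add_sum_coe {A B C : Finset (Finset V)} (h : Disjoint A B) (hC : A ∪ B = C)
    (f : Finset V → k) : ∑ x : A, f x + ∑ x : B, f x = ∑ x ∈ C, f x := by
  rw [Finset.sum_coe_sort A f, Finset.sum_coe_sort B f, ← hC, Finset.sum_union h]

/-- The suspension isomorphism between the homology of a complex on a non-empty vertex set and
the homology of its non-faces. -/
theorem contractsTo_nonfaces {H : Type*} [Fintype H] {gH : H → ℤ} {W : Finset V}
    (hW : W.Nonempty) {A B : Finset (Finset V)} (hAB : Disjoint A B) (hU : A ∪ B = W.powerset)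
    (hA : ∀ F ∈ A, ∀ G ⊆ F, G ∈ A)
    (h : ContractsTo (faceDeg A) (bdryMatrix k A A) gH) :
    ContractsTo (faceDeg B) (bdryMatrix k B B) (fun x => gH x + 1) := by
  obtain ⟨v, hv⟩ := hW
  have hsub : ∀ {F}, F ∈ A ∨ F ∈ B → F ⊆ W := fun {F} hF =>
    Finset.mem_powerset.1 (hU ▸ Finset.mem_union.2 hF)
  have hBA : ∀ (G : B) (F : A), bdryMatrix k B A G F = 0 := fun G F => by
    by_contra hne
    obtain ⟨x, -, hx⟩ := exists_erase_eq hne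
    exact Finset.disjoint_left.1 hAB (hA _ F.2 _ (hx ▸ Finset.erase_subset _ _)) G.2
  have hcone : ∀ (E F : Finset V), (F ∈ A ∨ F ∈ B) →
      (∑ G : A, bdryAux k G.1 E * coneAux k v F G.1 +
        ∑ G : B, bdryAux k G.1 E * coneAux k v F G.1) +
      (∑ G : A, coneAux k v G.1 E * bdryAux k F G.1 +
        ∑ G : B, coneAux k v G.1 E * bdryAux k F G.1) = if E = F then 1 else 0 := fun E F hF => by
    rw [sum_coe_add_sum_coe hAB hU fun G => bdryAux k G E * coneAux k v F G,
      sum_coe_add_sum_coe hAB hU fun G => coneAux k v G E * bdryAux k F G]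
    exact coneAux_homotopy hv (hsub hF)
  have hz1 : ∀ (E F : Finset V), F ∈ A → ∑ G : B, coneAux k v G.1 E * bdryAux k F G.1 = 0 :=
    fun E F hF => Finset.sum_eq_zero fun G _ => by
      rw [show bdryAux k F G.1 = 0 from hBA G ⟨F, hF⟩, mul_zero]
  have hz2 : ∀ (E F : Finset V), E ∈ B → ∑ G : A, bdryAux k G.1 E * coneAux k v F G.1 = 0 :=
    fun E F hE => Finset.sum_eq_zero fun G _ => by
      rw [show bdryAux k G.1 E = 0 from hBA ⟨E, hE⟩ G, zero_mul]
  refine ContractsTo.connecting (X := bdryMatrix k A B) (a := coneMatrix k v A A)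
    (c := coneMatrix k v B A) (d := coneMatrix k v B B) ?_ ?_ ?_ ?_ ?_ ?_ h
  · ext E F
    refine (sum_coe_add_sum_coe hAB hU fun G => bdryAux k G E.1 * bdryAux k F.1 G).trans ?_
    exact bdryAux_bdryAux fun x _ => Finset.mem_powerset.2
      ((Finset.erase_subset _ _).trans (hsub (Or.inr F.2)))
  · ext E F
    refine Eq.trans ?_ ((hcone E F (Or.inl F.2)).trans ?_)
    · rw [hz1 _ _ F.2, add_zero]
      rfl
    · change _ = @ite k (E = F) (Classical.propDecidable _) 1 0
      by_cases hEF : E = F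
      · rw [if_pos hEF, if_pos (congrArg _ hEF)]
      · rw [if_neg hEF, if_neg fun hn => hEF (Subtype.ext hn)]
  · ext E F
    have hne : E.1 ≠ F.1 := fun h => Finset.disjoint_left.1 hAB F.2 (h ▸ E.2)
    have := hcone E F (Or.inl F.2)
    rw [hz1 _ _ F.2, hz2 _ _ E.2, if_neg hne, zero_add, add_zero] at this
    exact this
  · ext E F
    refine Eq.trans ?_ ((hcone E F (Or.inr F.2)).trans ?_)
    · rw [hz2 _ _ E.2, zero_add, ← add_assoc]
      rfl
    · change _ = @ite k (E = F) (Classical.propDecidable _) 1 0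
      by_cases hEF : E = F
      · rw [if_pos hEF, if_pos (congrArg _ hEF)]
      · rw [if_neg hEF, if_neg fun hn => hEF (Subtype.ext hn)]
  · intro G F hGF
    exact card_eq_of_bdryAux_ne_zero hGF
  · intro G F hGF
    exact card_eq_of_coneAux_ne_zero hGF

end Simplicial

section Homology

variable {k : Type*} [Field k] {V : Type*}

/-- The chain with prescribed coefficients on a finite family of faces. -/
def chainEmb (k : Type*) [Field k] {V : Type*} (A : Finset (Finset V)) :
    (A → k) →ₗ[k] (Finset V →₀ k) :=
  Fintype.linearCombination k (fun F : A => Finsupp.single (F : Finset V) (1 : k))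

theorem chainEmb_apply (A : Finset (Finset V)) (w : A → k) :
    chainEmb k A w = ∑ F : A, w F • Finsupp.single (F : Finset V) (1 : k) := rfl

theorem chainEmb_apply_apply (A : Finset (Finset V)) (w : A → k) (F : A) :
    chainEmb k A w F.1 = w F := by
  rw [chainEmb_apply, Finsupp.finsetSum_apply, Finset.sum_eq_single F]
  · simp
  · intro G _ hG
    rw [Finsupp.smul_apply, Finsupp.single_eq_of_ne (fun h => hG (Subtype.ext h).symm), smul_zero]
  · exact fun h => absurd (Finset.mem_univ F) h

theorem chainEmb_injective (A : Finset (Finset V)) : Function.Injective (chainEmb k A) := by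
  intro w w' h
  funext F
  rw [← chainEmb_apply_apply A w F, h, chainEmb_apply_apply]

theorem chainSub_eq_map {Δ : Set (Finset V)} {A : Finset (Finset V)} (hA : ∀ F, F ∈ A ↔ F ∈ Δ)
    (n : ℕ) : chainSub k Δ n = (gradedPart k (faceDeg A) n).map (chainEmb k A) := by
  refine le_antisymm (Submodule.span_le.2 ?_) ?_
  · rintro _ ⟨F, ⟨hF, hn⟩, rfl⟩
    refine ⟨Pi.single ⟨F, (hA F).2 hF⟩ 1, ?_, ?_⟩
    · intro s hs
      have hs' : s = ⟨F, (hA F).2 hF⟩ := by_contra fun hn => hs (Pi.single_eq_of_ne hn _)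
      rw [hs', faceDeg, ← hn]
    · rw [chainEmb_apply, Finset.sum_eq_single ⟨F, (hA F).2 hF⟩]
      · rw [Pi.single_eq_same, one_smul]
      · intro G _ hG
        rw [Pi.single_eq_of_ne hG, zero_smul]
      · exact fun h => absurd (Finset.mem_univ _) h
  · rintro _ ⟨w, hw, rfl⟩
    rw [chainEmb_apply]
    refine Submodule.sum_mem _ fun F _ => ?_
    by_cases h0 : w F = 0
    · rw [h0, zero_smul]
      exact Submodule.zero_mem _
    · refine Submodule.smul_mem _ _ (Submodule.subset_span ⟨F.1, ⟨(hA _).1 F.2, ?_⟩, rfl⟩)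
      have := hw F h0
      simpa [faceDeg] using this

theorem bdryAux_eq_sum {A : Finset (Finset V)} (hA : ∀ F ∈ A, ∀ G ⊆ F, G ∈ A) (F : A) :
    bdryAux k F.1 = ∑ G : A, bdryAux k F.1 G.1 • Finsupp.single (G : Finset V) (1 : k) := by
  ext E
  rw [Finsupp.finsetSum_apply]
  by_cases hE : E ∈ A
  · rw [Finset.sum_eq_single ⟨E, hE⟩]
    · simp
    · intro G _ hG
      rw [Finsupp.smul_apply, Finsupp.single_eq_of_ne (fun h => hG (Subtype.ext h).symm),
        smul_zero]
    · exact fun h => absurd (Finset.mem_univ _) h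
  · rw [Finset.sum_eq_zero]
    · by_contra hne
      obtain ⟨x, -, hx⟩ := exists_erase_eq hne
      exact hE (hA _ F.2 _ (hx ▸ Finset.erase_subset _ _))
    · intro G _
      rw [Finsupp.smul_apply, Finsupp.single_eq_of_ne (fun h : E = G.1 => hE (h ▸ G.2)), smul_zero]

theorem bdry_chainEmb {A : Finset (Finset V)} (hA : ∀ F ∈ A, ∀ G ⊆ F, G ∈ A) (w : A → k) :
    bdry k V (chainEmb k A w) = chainEmb k A ((bdryMatrix k A A).mulVecLin w) := by
  rw [chainEmb_apply, chainEmb_apply, map_sum]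
  simp only [map_smul, bdry, Finsupp.linearCombination_single, one_smul, Matrix.mulVecLin_apply,
    Matrix.mulVec, dotProduct, Finset.sum_smul, bdryMatrix, Matrix.of_apply]
  rw [Finset.sum_comm]
  refine Finset.sum_congr rfl fun F _ => ?_
  conv_lhs => rw [bdryAux_eq_sum hA F]
  rw [Finset.smul_sum]
  refine Finset.sum_congr rfl fun G _ => ?_
  rw [smul_smul, mul_comm]

theorem hdim_eq_card {Δ : Set (Finset V)} {A : Finset (Finset V)} (hA : ∀ F, F ∈ A ↔ F ∈ Δ)
    (hcl : ∀ F ∈ A, ∀ G ⊆ F, G ∈ A) {H : Type*} [Fintype H] {gH : H → ℤ}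
    (h : ContractsTo (faceDeg A) (bdryMatrix k A A) gH) (n : ℕ) :
    hdim k Δ n = Fintype.card {x // gH x = n} := by
  have h1 : cycles k Δ n = (gradedPart k (faceDeg A) n ⊓
      LinearMap.ker (bdryMatrix k A A).mulVecLin).map (chainEmb k A) := by
    rw [cycles, chainSub_eq_map hA]
    ext c
    constructor
    · rintro ⟨⟨w, hw, rfl⟩, hc⟩
      refine ⟨w, ⟨hw, ?_⟩, rfl⟩
      rw [SetLike.mem_coe, LinearMap.mem_ker, bdry_chainEmb hcl] at hc
      exact chainEmb_injective A (hc.trans (map_zero _).symm)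
    · rintro ⟨w, ⟨hw, hw'⟩, rfl⟩
      refine ⟨⟨w, hw, rfl⟩, ?_⟩
      rw [SetLike.mem_coe, LinearMap.mem_ker] at hw' ⊢
      rw [bdry_chainEmb hcl, hw', map_zero]
  have h2 : bdries k Δ n = ((gradedPart k (faceDeg A) (n + 1)).map
      (bdryMatrix k A A).mulVecLin).map (chainEmb k A) := by
    rw [bdries, chainSub_eq_map hA, ← Submodule.map_comp, ← Submodule.map_comp,
      Nat.cast_add_one]
    congr 1
    exact LinearMap.ext (bdry_chainEmb hcl)
  rw [hdim, h1, h2,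
    ← (Submodule.equivMapOfInjective _ (chainEmb_injective A) _).finrank_eq,
    ← (Submodule.equivMapOfInjective _ (chainEmb_injective A) _).finrank_eq,
    h.finrank_eq (bdryMatrix_mul_self hcl) (faceDeg_of_bdryMatrix A A), Nat.add_sub_cancel_left]

theorem sum_T_eq_hgen {Δ : Set (Finset V)} {A : Finset (Finset V)} (hA : ∀ F, F ∈ A ↔ F ∈ Δ)
    (hcl : ∀ F ∈ A, ∀ G ⊆ F, G ∈ A) {H : Type*} [Fintype H] {gH : H → ℤ}
    (h : ContractsTo (faceDeg A) (bdryMatrix k A A) gH) {b : ℕ} (hb : ∀ F ∈ A, F.card ≤ b) :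
    ∑ x, (LaurentPolynomial.T (gH x) : LaurentPolynomial ℤ) =
      LaurentPolynomial.T 1 * hgen k Δ b := by
  rw [sum_T_eq_sum_card (b := b), hgen, Finset.mul_sum]
  · refine Finset.sum_congr rfl fun n _ => ?_
    rw [hdim_eq_card hA hcl h, mul_smul_comm, ← LaurentPolynomial.T_add]
    congr 2
    ring
  · intro x
    obtain ⟨F, hF⟩ := h.exists_grade_eq x
    have := hb F.1 F.2
    rw [← hF, faceDeg]
    omega

/-- The non-faces of a complex on a non-empty vertex set compute its reduced homology,
shifted by one degree. -/
theorem exists_contractsTo_nonfaces {Δ : Set (Finset V)} {W : Finset V} (hW : W.Nonempty)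
    (hΔ : ∀ F ∈ Δ, F ⊆ W) (hcl : ∀ F ∈ Δ, ∀ G ⊆ F, G ∈ Δ) {B : Finset (Finset V)}
    (hB : ∀ F, F ∈ B ↔ F ⊆ W ∧ F ∉ Δ) :
    ∃ (A : Finset (Finset V)) (p : Set A) (gH : p → ℤ),
      ContractsTo (faceDeg B) (bdryMatrix k B B) gH ∧
        ∑ x, (LaurentPolynomial.T (gH x) : LaurentPolynomial ℤ) =
          LaurentPolynomial.T 2 * hgen k Δ W.card := by
  let A := W.powerset.filter fun F => F ∈ Δ
  have hA : ∀ F, F ∈ A ↔ F ∈ Δ := fun F => by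
    simp only [A, Finset.mem_filter, Finset.mem_powerset, and_iff_right_iff_imp]
    exact hΔ F
  have hclA : ∀ F ∈ A, ∀ G ⊆ F, G ∈ A := fun F hF G hG =>
    (hA G).2 (hcl F ((hA F).1 hF) G hG)
  obtain ⟨p, hp⟩ := exists_contractsTo (faceDeg A) (bdryMatrix k A A) (bdryMatrix_mul_self hclA)
    (faceDeg_of_bdryMatrix A A)
  refine ⟨A, p, _, contractsTo_nonfaces hW ?_ ?_ hclA hp, ?_⟩
  · exact Finset.disjoint_left.2 fun F hF hF' => ((hB F).1 hF').2 ((hA F).1 hF)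
  · ext F
    rw [Finset.mem_union, hA, hB, Finset.mem_powerset]
    have := hΔ F
    tauto
  · simp only [LaurentPolynomial.T_add]
    rw [← Finset.sum_mul, sum_T_eq_hgen hA hclA hp
      fun F hF => Finset.card_le_card (hΔ F ((hA F).1 hF)), mul_right_comm,
      ← LaurentPolynomial.T_add]
    norm_num

end Homology

section Product

variable {k : Type*} [Field k] {V : Type*}

/-- The sign of the shuffle relating an ordered union of two disjoint faces to their
concatenation. -/
def crossSign (k : Type*) [Field k] {V : Type*} (F₁ F₂ : Finset V) : k := ∏ x ∈ F₁, vsign k F₂ x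

theorem crossSign_mul_self (F₁ F₂ : Finset V) :
    crossSign k F₁ F₂ * crossSign k F₁ F₂ = 1 := by
  rw [crossSign, ← Finset.prod_mul_distrib]
  exact Finset.prod_eq_one fun x _ => vsign_mul_self k F₂ x

theorem vsign_eq_crossSign_left {F₁ : Finset V} {x : V} (hx : x ∈ F₁) (F₂ : Finset V) :
    vsign k F₂ x = crossSign k (F₁.erase x) F₂ * crossSign k F₁ F₂ := by
  have h : crossSign k F₁ F₂ = vsign k F₂ x * crossSign k (F₁.erase x) F₂ :=
    (Finset.mul_prod_erase F₁ _ hx).symm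
  rw [h, mul_left_comm, crossSign_mul_self, mul_one]

theorem vsign_eq_crossSign_right {F₁ F₂ : Finset V} {x : V} (hx : x ∈ F₂) (hx' : x ∉ F₁) :
    vsign k F₁ x = crossSign k F₁ (F₂.erase x) * (-1) ^ F₁.card * crossSign k F₁ F₂ := by
  have h : crossSign k F₁ (F₂.erase x) = crossSign k F₁ F₂ * ((-1) ^ F₁.card * vsign k F₁ x) := by
    rw [crossSign, crossSign, vsign, ← Finset.prod_const, ← Finset.prod_mul_distrib,
      ← Finset.prod_mul_distrib]
    refine Finset.prod_congr rfl fun y hy => ?_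
    have hxy : x ≠ y := fun h => hx' (h ▸ hy)
    rw [vsign_erase hx, inv_swap k hxy, neg_one_mul]
  have h1 : (-1 : k) ^ F₁.card * (-1) ^ F₁.card = 1 := by
    rw [← mul_pow, neg_one_mul, neg_neg, one_pow]
  have h2 := crossSign_mul_self (k := k) F₁ F₂
  rw [h]
  linear_combination (-vsign k F₁ x) * ((-1 : k) ^ F₁.card * (-1) ^ F₁.card * h2 + h1)

theorem vsign_union {F₁ F₂ : Finset V} (h : Disjoint F₁ F₂) (x : V) :
    vsign k (F₁ ∪ F₂) x = vsign k F₁ x * vsign k F₂ x :=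
  Finset.prod_union h

theorem union_eq_union_iff {V₁ V₂ F₁ F₂ G₁ G₂ : Finset V} (hV : Disjoint V₁ V₂)
    (hF₁ : F₁ ⊆ V₁) (hF₂ : F₂ ⊆ V₂) (hG₁ : G₁ ⊆ V₁) (hG₂ : G₂ ⊆ V₂) :
    F₁ ∪ F₂ = G₁ ∪ G₂ ↔ F₁ = G₁ ∧ F₂ = G₂ := by
  have key : ∀ {E₁ E₂ : Finset V}, E₁ ⊆ V₁ → E₂ ⊆ V₂ →
      (E₁ ∪ E₂) ∩ V₁ = E₁ ∧ (E₁ ∪ E₂) ∩ V₂ = E₂ := fun {E₁ E₂} h₁ h₂ => by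
    constructor
    · rw [Finset.union_inter_distrib_right, Finset.inter_eq_left.2 h₁,
        Finset.disjoint_iff_inter_eq_empty.1 (hV.symm.mono_left h₂), Finset.union_empty]
    · rw [Finset.union_inter_distrib_right, Finset.inter_eq_left.2 h₂,
        Finset.disjoint_iff_inter_eq_empty.1 (hV.mono_left h₁), Finset.empty_union]
  refine ⟨fun h => ⟨?_, ?_⟩, fun h => by rw [h.1, h.2]⟩
  · rw [← (key hF₁ hF₂).1, h, (key hG₁ hG₂).1]
  · rw [← (key hF₁ hF₂).2, h, (key hG₁ hG₂).2]

theorem bdryAux_union {V₁ V₂ F₁ F₂ G₁ G₂ : Finset V} (hV : Disjoint V₁ V₂)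
    (hF₁ : F₁ ⊆ V₁) (hF₂ : F₂ ⊆ V₂) (hG₁ : G₁ ⊆ V₁) (hG₂ : G₂ ⊆ V₂) :
    bdryAux k (F₁ ∪ F₂) (G₁ ∪ G₂) =
      crossSign k G₁ G₂ * (bdryAux k F₁ G₁ * (if G₂ = F₂ then 1 else 0) +
        (if G₁ = F₁ then (-1) ^ G₁.card else 0) * bdryAux k F₂ G₂) * crossSign k F₁ F₂ := by
  have hF : Disjoint F₁ F₂ := (hV.mono_left hF₁).mono_right hF₂
  rw [bdryAux_apply, Finset.sum_union hF, mul_add, add_mul]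
  congr 1
  · rw [bdryAux_apply, Finset.sum_mul, Finset.mul_sum, Finset.sum_mul]
    refine Finset.sum_congr rfl fun x hx => ?_
    have hx' : x ∉ F₂ := Finset.disjoint_left.1 hF hx
    rw [Finset.erase_union_distrib, Finset.erase_eq_of_notMem hx', vsign_union hF,
      vsign_eq_crossSign_left hx F₂]
    simp only [union_eq_union_iff hV ((Finset.erase_subset x F₁).trans hF₁) hF₂ hG₁ hG₂]
    by_cases h₁ : F₁.erase x = G₁
    · by_cases h₂ : F₂ = G₂
      · subst h₁ h₂
        simp only [and_self, if_true]
        ring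
      · simp [h₂, Ne.symm h₂]
    · simp [h₁]
  · rw [bdryAux_apply, Finset.mul_sum, Finset.mul_sum, Finset.sum_mul]
    refine Finset.sum_congr rfl fun x hx => ?_
    have hx' : x ∉ F₁ := Finset.disjoint_right.1 hF hx
    rw [Finset.erase_union_distrib, Finset.erase_eq_of_notMem hx', vsign_union hF,
      vsign_eq_crossSign_right hx hx']
    simp only [union_eq_union_iff hV hF₁ ((Finset.erase_subset x F₂).trans hF₂) hG₁ hG₂]
    by_cases h₂ : F₂.erase x = G₂
    · by_cases h₁ : F₁ = G₁
      · subst h₁ h₂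
        simp only [and_self, if_true]
        ring
      · simp [h₁, Ne.symm h₁]
    · simp [h₂]

/-- The sign involution of a graded family of faces. -/
def signMatrix (k : Type*) [Field k] {V : Type*} (A : Finset (Finset V)) : Matrix A A k :=
  Matrix.diagonal fun F => (-1) ^ F.1.card

theorem signMatrix_mul_self (A : Finset (Finset V)) : signMatrix k A * signMatrix k A = 1 := by
  rw [signMatrix, Matrix.diagonal_mul_diagonal, ← Matrix.diagonal_one]
  congr 1
  funext F
  rw [← mul_pow, neg_one_mul, neg_neg, one_pow]

theorem bdryMatrix_signMatrix (A : Finset (Finset V)) :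
    bdryMatrix k A A * signMatrix k A + signMatrix k A * bdryMatrix k A A = 0 := by
  ext G F
  rw [Matrix.add_apply, signMatrix, Matrix.mul_diagonal, Matrix.diagonal_mul, Matrix.zero_apply]
  by_cases h : bdryMatrix k A A G F = 0
  · rw [h, zero_mul, mul_zero, add_zero]
  · have h1 := faceDeg_of_bdryMatrix A A G F h
    have h2 : F.1.card = G.1.card + 1 := by
      simp only [faceDeg] at h1
      omega
    rw [h2, pow_succ]
    ring

theorem contractsTo_union {V₁ V₂ : Finset V} (hV : Disjoint V₁ V₂) {A₁ A₂ A : Finset (Finset V)}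
    (hA₁ : ∀ F ∈ A₁, F ⊆ V₁) (hA₂ : ∀ F ∈ A₂, F ⊆ V₂)
    (hA : ∀ F, F ∈ A ↔ F ⊆ V₁ ∪ V₂ ∧ F ∩ V₁ ∈ A₁ ∧ F ∩ V₂ ∈ A₂)
    {H₁ H₂ : Type*} [Fintype H₁] [Fintype H₂] {g₁ : H₁ → ℤ} {g₂ : H₂ → ℤ}
    (h₁ : ContractsTo (faceDeg A₁) (bdryMatrix k A₁ A₁) g₁)
    (h₂ : ContractsTo (faceDeg A₂) (bdryMatrix k A₂ A₂) g₂) :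
    ContractsTo (faceDeg A) (bdryMatrix k A A) (fun x : H₁ × H₂ => g₁ x.1 + g₂ x.2) := by
  have hsplit : ∀ F : A, F.1 ∩ V₁ ∪ F.1 ∩ V₂ = F.1 := fun F => by
    rw [← Finset.inter_union_distrib_left, Finset.inter_eq_left.2 ((hA _).1 F.2).1]
  let f : A → A₁ × A₂ := fun F => (⟨F.1 ∩ V₁, ((hA _).1 F.2).2.1⟩, ⟨F.1 ∩ V₂, ((hA _).1 F.2).2.2⟩)
  have hf : Function.Bijective f := by
    constructor
    · intro F G h
      have h₁ : F.1 ∩ V₁ = G.1 ∩ V₁ := congrArg (fun x => x.1.1) h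
      have h₂ : F.1 ∩ V₂ = G.1 ∩ V₂ := congrArg (fun x => x.2.1) h
      exact Subtype.ext (by rw [← hsplit F, ← hsplit G, h₁, h₂])
    · rintro ⟨⟨F₁, hF₁⟩, ⟨F₂, hF₂⟩⟩
      have hs₁ := hA₁ _ hF₁
      have hs₂ := hA₂ _ hF₂
      have e₁ : (F₁ ∪ F₂) ∩ V₁ = F₁ := by
        rw [Finset.union_inter_distrib_right, Finset.inter_eq_left.2 hs₁,
          Finset.disjoint_iff_inter_eq_empty.1 (hV.symm.mono_left hs₂), Finset.union_empty]
      have e₂ : (F₁ ∪ F₂) ∩ V₂ = F₂ := by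
        rw [Finset.union_inter_distrib_right, Finset.inter_eq_left.2 hs₂,
          Finset.disjoint_iff_inter_eq_empty.1 (hV.mono_left hs₁), Finset.empty_union]
      refine ⟨⟨F₁ ∪ F₂, (hA _).2 ⟨Finset.union_subset_union hs₁ hs₂, ?_, ?_⟩⟩, ?_⟩
      · rwa [e₁]
      · rwa [e₂]
      · exact Prod.ext (Subtype.ext e₁) (Subtype.ext e₂)
  refine (ContractsTo.kronecker (signMatrix k A₁) (by convert signMatrix_mul_self (k := k) A₁)
    (bdryMatrix_signMatrix A₁) h₁ h₂).rescale (Equiv.ofBijective f hf)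
    (fun F => crossSign k (F.1 ∩ V₁) (F.1 ∩ V₂)) (fun F => crossSign_mul_self _ _) ?_ ?_
  · intro F
    have := Finset.card_union_of_disjoint
      ((hV.mono_left (Finset.inter_subset_right (s₁ := F.1))).mono_right
        (Finset.inter_subset_right (s₁ := F.1)))
    rw [hsplit] at this
    simp only [faceDeg, Equiv.ofBijective_apply, f]
    rw [this, Nat.cast_add]
  · intro G F
    have := bdryAux_union (k := k) hV (F₁ := F.1 ∩ V₁) (F₂ := F.1 ∩ V₂) (G₁ := G.1 ∩ V₁)
      (G₂ := G.1 ∩ V₂) Finset.inter_subset_right Finset.inter_subset_right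
      Finset.inter_subset_right Finset.inter_subset_right
    rw [hsplit, hsplit] at this
    refine this.trans ?_
    congr 2
    rw [Matrix.add_apply, Matrix.kronecker_apply, Matrix.kronecker_apply, signMatrix]
    simp only [Equiv.ofBijective_apply, f]
    congr 2
    · by_cases h : G.1 ∩ V₂ = F.1 ∩ V₂
      · rw [if_pos h]
        exact (if_pos (Subtype.ext h)).symm
      · rw [if_neg h]
        exact (if_neg fun hn => h (congrArg Subtype.val hn)).symm
    · by_cases h : G.1 ∩ V₁ = F.1 ∩ V₁
      · rw [if_pos h]
        exact (if_pos (Subtype.ext h)).symm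
      · rw [if_neg h]
        exact (if_neg fun hn => h (congrArg Subtype.val hn)).symm

theorem exists_contractsTo_biUnion {V : Type} {ι : Type*} {s : Finset ι} (hs : s.Nonempty)
    {Vs : ι → Finset V} {Δs : ι → Set (Finset V)}
    (hdisj : ∀ i j, i ≠ j → Disjoint (Vs i) (Vs j))
    (hne : ∀ i, (Vs i).Nonempty) (hvert : ∀ i, ∀ F ∈ Δs i, F ⊆ Vs i)
    (hcl : ∀ i, ∀ F ∈ Δs i, ∀ G ⊆ F, G ∈ Δs i) : ∀ {B : Finset (Finset V)},
    (∀ F, F ∈ B ↔ F ⊆ s.biUnion Vs ∧ ∀ i ∈ s, F ∩ Vs i ∉ Δs i) →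
    ∃ (H : Type) (_ : Fintype H) (gH : H → ℤ),
      ContractsTo (faceDeg B) (bdryMatrix k B B) gH ∧
        ∑ x, (LaurentPolynomial.T (gH x) : LaurentPolynomial ℤ) =
          ∏ i ∈ s, (LaurentPolynomial.T 2 * hgen k (Δs i) (Vs i).card) := by
  induction hs using Finset.Nonempty.cons_induction with
  | singleton i =>
    intro B hB
    obtain ⟨A, p, gH, h, hsum⟩ := exists_contractsTo_nonfaces (k := k) (hne i) (hvert i) (hcl i)
      (B := B) fun F => by
        rw [hB, Finset.singleton_biUnion]
        refine and_congr_right fun hF => ?_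
        simp only [Finset.mem_singleton, forall_eq, Finset.inter_eq_left.2 hF]
    exact ⟨p, inferInstance, gH, h, by rw [hsum, Finset.prod_singleton]⟩
  | cons i s hi hs ih =>
    intro B hB
    let B₁ := (Vs i).powerset.filter fun F => F ∉ Δs i
    let B₂ := (s.biUnion Vs).powerset.filter fun F => ∀ j ∈ s, F ∩ Vs j ∉ Δs j
    have hB₁ : ∀ F, F ∈ B₁ ↔ F ⊆ Vs i ∧ F ∉ Δs i := fun F => by
      rw [Finset.mem_filter, Finset.mem_powerset]
    have hB₂ : ∀ F, F ∈ B₂ ↔ F ⊆ s.biUnion Vs ∧ ∀ j ∈ s, F ∩ Vs j ∉ Δs j := fun F => by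
      rw [Finset.mem_filter, Finset.mem_powerset]
    obtain ⟨A, p, g₁, h₁, hsum₁⟩ :=
      exists_contractsTo_nonfaces (k := k) (hne i) (hvert i) (hcl i) hB₁
    obtain ⟨H, _, g₂, h₂, hsum₂⟩ := ih hB₂
    have hV : Disjoint (Vs i) (s.biUnion Vs) := by
      rw [Finset.disjoint_biUnion_right]
      exact fun j hj => hdisj i j fun h => hi (h ▸ hj)
    refine ⟨p × H, inferInstance, _, contractsTo_union hV (fun F hF => ((hB₁ F).1 hF).1)
      (fun F hF => ((hB₂ F).1 hF).1) ?_ h₁ h₂, ?_⟩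
    · intro F
      rw [hB, hB₁, hB₂, Finset.cons_eq_insert, Finset.biUnion_insert, Finset.forall_mem_insert]
      refine and_congr_right fun _ => and_congr ?_ ?_
      · simp only [Finset.inter_subset_right, true_and]
      · simp only [Finset.inter_subset_right, true_and]
        refine forall₂_congr fun j hj => ?_
        rw [Finset.inter_assoc, Finset.inter_eq_right.2 (Finset.subset_biUnion_of_mem Vs hj)]
    · simp only [LaurentPolynomial.T_add]
      rw [Finset.prod_cons, ← hsum₁, ← hsum₂, Finset.sum_mul_sum, Fintype.sum_prod_type]

end Product
end MonomialRings

/-- **Lemma (generating function of the dual join).**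
Let `Δ₁,…,Δ_r` (`r ≥ 1`) be simplicial complexes on pairwise disjoint non-empty finite
vertex sets.  Then the generating functions of reduced homology with coefficients in a
field `k` satisfy `H̃(Δ₁·…·Δ_r;k)(z) = z^{2r-2}·H̃(Δ₁;k)(z)·…·H̃(Δ_r;k)(z)`. -/
theorem dualJoin_generating_function
    (k : Type) [Field k] (V : Type) (r : ℕ) (hr : 1 ≤ r)
    (Vs : Fin r → Finset V) (Δs : Fin r → Set (Finset V))
    (hdisj : ∀ i j, i ≠ j → Disjoint (Vs i) (Vs j))
    (hne : ∀ i, (Vs i).Nonempty)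
    (hvert : ∀ i, ∀ F ∈ Δs i, F ⊆ Vs i)
    (hcl : ∀ i, ∀ F ∈ Δs i, ∀ G ⊆ F, G ∈ Δs i) :
    hgen k (dualJoin Vs Δs) (∑ i, (Vs i).card)
      = LaurentPolynomial.T (2 * (r : ℤ) - 2) * ∏ i, hgen k (Δs i) (Vs i).card := by
  have hs : (Finset.univ : Finset (Fin r)).Nonempty := ⟨⟨0, hr⟩, Finset.mem_univ _⟩
  let W : Finset V := Finset.univ.biUnion Vs
  have hmem : ∀ F : Finset V, F ∈ dualJoin Vs Δs ↔ F ⊆ W ∧ ∃ i, F ∩ Vs i ∈ Δs i := fun F => by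
    have hW : (⋃ i, (Vs i : Set V)) = (W : Set V) := by simp [W]
    change (F : Set V) ⊆ (⋃ i, (Vs i : Set V)) ∧ _ ↔ _
    rw [hW, Finset.coe_subset]
  let B := W.powerset.filter fun F => ∀ i ∈ Finset.univ, F ∩ Vs i ∉ Δs i
  have hB : ∀ F, F ∈ B ↔ F ⊆ W ∧ ∀ i ∈ Finset.univ, F ∩ Vs i ∉ Δs i := fun F => by
    rw [Finset.mem_filter, Finset.mem_powerset]
  have hW : W.Nonempty := hs.biUnion fun i _ => hne i
  obtain ⟨H, _, g, h, hsum⟩ := exists_contractsTo_biUnion (k := k) hs hdisj hne hvert hcl hB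
  obtain ⟨A, p, g', h', hsum'⟩ := exists_contractsTo_nonfaces (k := k) (Δ := dualJoin Vs Δs)
    (W := W) hW (fun F hF => ((hmem F).1 hF).1)
    (fun F hF G hG => (hmem G).2 ⟨hG.trans ((hmem F).1 hF).1,
      ((hmem F).1 hF).2.imp fun i hi => hcl i _ hi _ (Finset.inter_subset_inter_right hG)⟩)
    (B := B) fun F => by
      rw [hB, hmem]
      simp only [Finset.mem_univ, true_imp_iff]
      tauto
  have hcard : W.card = ∑ i, (Vs i).card :=
    Finset.card_biUnion fun i _ j _ hij => hdisj i j hij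
  have key := h'.sum_T_eq h
  rw [hsum, hsum', hcard, Finset.prod_mul_distrib, Finset.prod_const, Finset.card_univ,
    Fintype.card_fin, LaurentPolynomial.T_pow] at key
  have h2 := congrArg (fun q => LaurentPolynomial.T (-2) * q) key
  simp only [← mul_assoc, ← LaurentPolynomial.T_add] at h2
  rw [show (-2 + 2 : ℤ) = 0 by norm_num, LaurentPolynomial.T_zero, one_mul] at h2
  rw [h2]
  congr 2
  ring
end
end

section
/- Let M be the minimal generating set (an antichain) of a monomial ideal I, and let cL_I denote the set of elements l ≠ 1 of the lcm-lattice L_I such that M_l is connected, and D(cL_I) the set of non-empty discrete subsets of cL_I. Then the assignment N ↦ M_N is a bijection from D(cL_I) onto sat(M), with inverse sending a saturated set S with connected components S_1,…,S_r to N = {m_{S_1},…,m_{S_r}}; moreover under this correspondence m_S = m_N, c(S) = |N|, and M_N = M_{α_1} ∪ … ∪ M_{α_r} is exactly the decomposition of M_N into connected components when N = {x^{α_1},…,x^{α_r}}. -/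
noncomputable section
attribute [local instance] Classical.propDecidable

namespace MonomialRings

/-- `cL_I`: the set of elements `l ≠ 1` of the lcm-lattice such that `M_l` is
connected. -/
def cLcmLattice {σ : Type*} (M : Finset (Mon σ)) : Finset (Mon σ) :=
  (lcmLattice M).filter (fun l => l ≠ 0 ∧ IsConnected (divisorsIn M l))

/-- `D(cL_I)`: the non-empty discrete subsets of `cL_I`. -/
def discreteSubsets {σ : Type*} (N : Finset (Mon σ)) : Finset (Finset (Mon σ)) :=
  N.powerset.filter (fun S => S.Nonempty ∧ Discrete S)

end MonomialRings

namespace MonomialRings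

section Graph

variable {σ : Type*}

theorem NCF.symm {a b : Mon σ} (h : NCF a b) : NCF b a :=
  let ⟨i, ha, hb⟩ := h
  ⟨i, hb, ha⟩

theorem NCF.mono {a b c d : Mon σ} (h : NCF a b) (hac : a ≤ c) (hbd : b ≤ d) : NCF c d := by
  obtain ⟨i, ha, hb⟩ := h
  exact ⟨i, ((Nat.pos_of_ne_zero ha).trans_le (hac i)).ne',
    ((Nat.pos_of_ne_zero hb).trans_le (hbd i)).ne'⟩

theorem ncf_self {a : Mon σ} (ha : a ≠ 0) : NCF a a := by
  obtain ⟨i, hi⟩ := Function.ne_iff.mp ha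
  exact ⟨i, hi, hi⟩

theorem ConnIn.refl {S : Finset (Mon σ)} {a : Mon σ} (ha : a ∈ S) : ConnIn S a a :=
  ⟨ha, ha, .refl⟩

theorem ConnIn.trans {S : Finset (Mon σ)} {a b c : Mon σ}
    (hab : ConnIn S a b) (hbc : ConnIn S b c) : ConnIn S a c :=
  ⟨hab.1, hbc.2.1, hab.2.2.trans hbc.2.2⟩

theorem ConnIn.symm {S : Finset (Mon σ)} {a b : Mon σ} (h : ConnIn S a b) : ConnIn S b a := by
  obtain ⟨ha, hb, h⟩ := h
  refine ⟨hb, ha, ?_⟩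
  induction h with
  | refl => exact .refl
  | tail _ huv ih =>
    exact .head ⟨huv.2.1, huv.1, huv.2.2.1.symm, huv.2.2.2.symm⟩ (ih huv.1)

theorem ConnIn.mono {S T : Finset (Mon σ)} (hST : S ⊆ T) {a b : Mon σ} (h : ConnIn S a b) :
    ConnIn T a b :=
  ⟨hST h.1, hST h.2.1, Relation.ReflTransGen.mono
    (fun _ _ huv => ⟨hST huv.1, hST huv.2.1, huv.2.2⟩) _ _ h.2.2⟩

theorem ConnIn.of_ncf {S : Finset (Mon σ)} {a b : Mon σ} (ha : a ∈ S) (hb : b ∈ S)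
    (h : NCF a b) : ConnIn S a b := by
  by_cases hab : a = b
  · subst hab
    exact .refl ha
  · exact ⟨ha, hb, .single ⟨ha, hb, hab, h⟩⟩

theorem ConnIn.mem_of_closed {S A : Finset (Mon σ)}
    (hA : ∀ u ∈ A, ∀ v ∈ S, NCF u v → v ∈ A) {a b : Mon σ} (ha : a ∈ A)
    (h : ConnIn S a b) : b ∈ A := by
  obtain ⟨-, -, h⟩ := h
  induction h with
  | refl => exact ha
  | tail _ huv ih => exact hA _ ih _ huv.2.1 huv.2.2.2

theorem mem_compOf {S : Finset (Mon σ)} {a b : Mon σ} : b ∈ compOf S a ↔ ConnIn S a b := by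
  simp only [compOf, Finset.mem_filter, and_iff_right_iff_imp]
  exact fun h => h.2.1

theorem compOf_subset (S : Finset (Mon σ)) (a : Mon σ) : compOf S a ⊆ S :=
  Finset.filter_subset _ _

theorem compOf_closed (S : Finset (Mon σ)) (a : Mon σ) :
    ∀ u ∈ compOf S a, ∀ v ∈ S, NCF u v → v ∈ compOf S a := by
  intro u hu v hv huv
  rw [mem_compOf] at hu ⊢
  exact hu.trans (.of_ncf hu.2.1 hv huv)

theorem compOf_eq_of_closed {S C : Finset (Mon σ)} (hCS : C ⊆ S) (hC : IsConnected C)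
    (hcl : ∀ u ∈ C, ∀ v ∈ S, NCF u v → v ∈ C) {a : Mon σ} (ha : a ∈ C) : compOf S a = C := by
  ext b
  rw [mem_compOf]
  exact ⟨fun h => h.mem_of_closed hcl ha, fun hb => (hC.2 a ha b hb).mono hCS⟩

theorem isConnected_compOf {S : Finset (Mon σ)} {a : Mon σ} (ha : a ∈ S) :
    IsConnected (compOf S a) := by
  have key : ∀ b, ConnIn S a b → ConnIn (compOf S a) a b := by
    rintro b ⟨-, -, h⟩
    induction h with
    | refl => exact .refl (mem_compOf.2 (.refl ha))
    | tail _ huv ih =>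
      exact ih.trans (.of_ncf ih.2.1 (compOf_closed S a _ ih.2.1 _ huv.2.1 huv.2.2.2) huv.2.2.2)
  refine ⟨⟨a, mem_compOf.2 (.refl ha)⟩, fun b hb c hc => ?_⟩
  exact (key b (mem_compOf.1 hb)).symm.trans (key c (mem_compOf.1 hc))

end Graph

section Lcm

variable {σ : Type*}

theorem le_mlcm {S : Finset (Mon σ)} {a : Mon σ} (ha : a ∈ S) : a ≤ mlcm S :=
  Finset.le_sup (f := id) ha

theorem mlcm_le {S : Finset (Mon σ)} {l : Mon σ} (h : ∀ a ∈ S, a ≤ l) : mlcm S ≤ l :=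
  Finset.sup_le h

theorem exists_apply_ne_zero_of_mlcm {S : Finset (Mon σ)} {i : σ} (h : mlcm S i ≠ 0) :
    ∃ a ∈ S, a i ≠ 0 := by
  by_contra! hS
  apply h
  rw [mlcm, Finset.sup_apply]
  exact Nat.le_zero.mp (Finset.sup_le fun a ha => (hS a ha).le)

theorem NCF.exists_of_mlcm {S : Finset (Mon σ)} {b : Mon σ} (h : NCF (mlcm S) b) :
    ∃ a ∈ S, NCF a b := by
  obtain ⟨i, hS, hb⟩ := h
  obtain ⟨a, ha, hai⟩ := exists_apply_ne_zero_of_mlcm hS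
  exact ⟨a, ha, i, hai, hb⟩

theorem mem_divisorsIn {M : Finset (Mon σ)} {l m : Mon σ} :
    m ∈ divisorsIn M l ↔ m ∈ M ∧ m ≤ l :=
  Finset.mem_filter

theorem mem_divisorsInSet {M N : Finset (Mon σ)} {m : Mon σ} :
    m ∈ divisorsInSet M N ↔ m ∈ M ∧ ∃ l ∈ N, m ≤ l :=
  Finset.mem_filter

theorem mlcm_divisorsIn {M : Finset (Mon σ)} {l : Mon σ} (hl : l ∈ lcmLattice M) :
    mlcm (divisorsIn M l) = l := by
  obtain ⟨S, hS, rfl⟩ := Finset.mem_image.1 hl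
  refine le_antisymm (mlcm_le fun a ha => (mem_divisorsIn.1 ha).2) (mlcm_le fun a ha => ?_)
  exact le_mlcm (mem_divisorsIn.2 ⟨Finset.mem_powerset.1 hS ha, le_mlcm ha⟩)

end Lcm

section Saturated

variable {σ : Type*} {M S : Finset (Mon σ)}

theorem mem_satSets : S ∈ satSets M ↔ S.Nonempty ∧ Saturated M S := by
  simp only [satSets, Finset.mem_filter, Finset.mem_powerset, and_iff_right_iff_imp]
  exact fun h => h.2.1

theorem Saturated.divisorsIn_mlcm_compOf (h0 : ∀ m ∈ M, m ≠ 0) (hS : Saturated M S)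
    {a : Mon σ} (ha : a ∈ S) : divisorsIn M (mlcm (compOf S a)) = compOf S a := by
  ext m
  rw [mem_divisorsIn]
  refine ⟨fun ⟨hm, hle⟩ => ?_, fun hm => ⟨hS.1 (compOf_subset S a hm), le_mlcm hm⟩⟩
  have hmS := hS.2 m hm _ (compOf_subset S a) (isConnected_compOf ha) hle
  obtain ⟨c, hc, hcm⟩ := ((ncf_self (h0 m hm)).mono hle le_rfl).exists_of_mlcm
  exact compOf_closed S a c hc m hmS hcm

theorem Saturated.mlcm_compOf_mem (h0 : ∀ m ∈ M, m ≠ 0) (hS : Saturated M S)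
    {a : Mon σ} (ha : a ∈ S) : mlcm (compOf S a) ∈ cLcmLattice M := by
  refine Finset.mem_filter.2 ⟨Finset.mem_image_of_mem _ (Finset.mem_powerset.2
    ((compOf_subset S a).trans hS.1)), fun h => h0 a (hS.1 ha) ?_, ?_⟩
  · exact le_antisymm (h ▸ le_mlcm (mem_compOf.2 (.refl ha))) (fun i => Nat.zero_le _)
  · rw [hS.divisorsIn_mlcm_compOf h0 ha]
    exact isConnected_compOf ha

theorem discrete_image_mlcm_components (S : Finset (Mon σ)) :
    Discrete ((components S).image mlcm) := by
  intro x hx y hy hne hxy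
  simp only [components, Finset.mem_image, exists_exists_and_eq_and] at hx hy
  obtain ⟨a, ha, rfl⟩ := hx
  obtain ⟨b, hb, rfl⟩ := hy
  obtain ⟨u, hu, huy⟩ := hxy.exists_of_mlcm
  obtain ⟨v, hv, hvu⟩ := huy.symm.exists_of_mlcm
  apply hne
  rw [compOf_eq_of_closed (compOf_subset S b) (isConnected_compOf hb) (compOf_closed S b)
      (compOf_closed S b v hv u (compOf_subset S a hu) hvu) |>.symm,
    compOf_eq_of_closed (compOf_subset S a) (isConnected_compOf ha) (compOf_closed S a) hu]

theorem Saturated.image_mlcm_components_mem (h0 : ∀ m ∈ M, m ≠ 0) (hne : S.Nonempty)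
    (hS : Saturated M S) : (components S).image mlcm ∈ discreteSubsets (cLcmLattice M) := by
  refine Finset.mem_filter.2 ⟨Finset.mem_powerset.2 fun l hl => ?_,
    (hne.image _).image _, discrete_image_mlcm_components S⟩
  simp only [components, Finset.mem_image, exists_exists_and_eq_and] at hl
  obtain ⟨a, ha, rfl⟩ := hl
  exact hS.mlcm_compOf_mem h0 ha

theorem Saturated.divisorsInSet_image_mlcm_components (hS : Saturated M S) :
    divisorsInSet M ((components S).image mlcm) = S := by
  ext m
  simp only [mem_divisorsInSet, components, Finset.mem_image, exists_exists_and_eq_and]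
  constructor
  · rintro ⟨hm, a, ha, hle⟩
    exact hS.2 m hm _ (compOf_subset S a) (isConnected_compOf ha) hle
  · exact fun hm => ⟨hS.1 hm, m, hm, le_mlcm (mem_compOf.2 (.refl hm))⟩

end Saturated

section DiscreteSubsets

variable {σ : Type*} {M N : Finset (Mon σ)}

theorem mem_discreteSubsets {L : Finset (Mon σ)} :
    N ∈ discreteSubsets L ↔ N ⊆ L ∧ N.Nonempty ∧ Discrete N := by
  simp only [discreteSubsets, Finset.mem_filter, Finset.mem_powerset]

theorem mem_cLcmLattice {l : Mon σ} :
    l ∈ cLcmLattice M ↔ l ∈ lcmLattice M ∧ l ≠ 0 ∧ IsConnected (divisorsIn M l) :=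
  Finset.mem_filter

theorem divisorsIn_subset_divisorsInSet {l : Mon σ} (hl : l ∈ N) :
    divisorsIn M l ⊆ divisorsInSet M N := fun _ hm =>
  have h := mem_divisorsIn.1 hm
  mem_divisorsInSet.2 ⟨h.1, l, hl, h.2⟩

theorem Discrete.divisorsIn_closed (hN : Discrete N) {l : Mon σ} (hl : l ∈ N) :
    ∀ u ∈ divisorsIn M l, ∀ v ∈ divisorsInSet M N, NCF u v → v ∈ divisorsIn M l := by
  intro u hu v hv huv
  obtain ⟨hvM, k, hk, hvk⟩ := mem_divisorsInSet.1 hv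
  by_cases hlk : l = k
  · exact mem_divisorsIn.2 ⟨hvM, hlk ▸ hvk⟩
  · exact absurd (huv.mono (mem_divisorsIn.1 hu).2 hvk) (hN l hl k hk hlk)

theorem Discrete.compOf_divisorsInSet (hN : Discrete N) (hNM : N ⊆ cLcmLattice M) {l a : Mon σ}
    (hl : l ∈ N) (ha : a ∈ divisorsIn M l) : compOf (divisorsInSet M N) a = divisorsIn M l :=
  compOf_eq_of_closed (divisorsIn_subset_divisorsInSet hl) (mem_cLcmLattice.1 (hNM hl)).2.2
    (hN.divisorsIn_closed hl) ha

theorem Discrete.components_divisorsInSet (hN : Discrete N) (hNM : N ⊆ cLcmLattice M) :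
    components (divisorsInSet M N) = N.image (fun l => divisorsIn M l) := by
  ext C
  simp only [components, Finset.mem_image]
  constructor
  · rintro ⟨a, ha, rfl⟩
    obtain ⟨haM, l, hl, hal⟩ := mem_divisorsInSet.1 ha
    exact ⟨l, hl, (hN.compOf_divisorsInSet hNM hl (mem_divisorsIn.2 ⟨haM, hal⟩)).symm⟩
  · rintro ⟨l, hl, rfl⟩
    obtain ⟨a, ha⟩ := (mem_cLcmLattice.1 (hNM hl)).2.2.1
    exact ⟨a, divisorsIn_subset_divisorsInSet hl ha, hN.compOf_divisorsInSet hNM hl ha⟩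

theorem Discrete.image_mlcm_components_divisorsInSet (hN : Discrete N)
    (hNM : N ⊆ cLcmLattice M) : (components (divisorsInSet M N)).image mlcm = N := by
  rw [hN.components_divisorsInSet hNM, Finset.image_image]
  exact (Finset.image_congr fun l hl => mlcm_divisorsIn (mem_cLcmLattice.1 (hNM hl)).1).trans
    Finset.image_id

theorem Discrete.ncomp_divisorsInSet (hN : Discrete N) (hNM : N ⊆ cLcmLattice M) :
    ncomp (divisorsInSet M N) = N.card := by
  rw [ncomp, hN.components_divisorsInSet hNM]
  refine Finset.card_image_of_injOn fun l hl k hk h => ?_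
  rw [← mlcm_divisorsIn (mem_cLcmLattice.1 (hNM hl)).1,
    ← mlcm_divisorsIn (mem_cLcmLattice.1 (hNM hk)).1]
  exact congrArg mlcm h

theorem mlcm_divisorsInSet (hNM : N ⊆ lcmLattice M) :
    mlcm (divisorsInSet M N) = mlcm N := by
  refine le_antisymm (mlcm_le fun m hm => ?_) (mlcm_le fun l hl => ?_)
  · obtain ⟨-, l, hl, hml⟩ := mem_divisorsInSet.1 hm
    exact hml.trans (le_mlcm hl)
  · rw [← mlcm_divisorsIn (hNM hl)]
    exact mlcm_le fun _ hm => le_mlcm (divisorsIn_subset_divisorsInSet hl hm)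

theorem Discrete.saturated_divisorsInSet (hN : Discrete N) :
    Saturated M (divisorsInSet M N) := by
  refine ⟨Finset.filter_subset _ _, fun m hm T hT hTc hmT => ?_⟩
  obtain ⟨a, ha⟩ := hTc.1
  obtain ⟨haM, l, hl, hal⟩ := mem_divisorsInSet.1 (hT ha)
  refine mem_divisorsInSet.2 ⟨hm, l, hl, hmT.trans (mlcm_le fun b hb => ?_)⟩
  exact (mem_divisorsIn.1 (((hTc.2 a ha b hb).mono hT).mem_of_closed (hN.divisorsIn_closed hl)
    (mem_divisorsIn.2 ⟨haM, hal⟩))).2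

theorem divisorsInSet_mem_satSets (hN : N ∈ discreteSubsets (cLcmLattice M)) :
    divisorsInSet M N ∈ satSets M := by
  obtain ⟨hNM, ⟨l, hl⟩, hd⟩ := mem_discreteSubsets.1 hN
  exact mem_satSets.2 ⟨(mem_cLcmLattice.1 (hNM hl)).2.2.1.mono
    (divisorsIn_subset_divisorsInSet hl), hd.saturated_divisorsInSet⟩

end DiscreteSubsets

end MonomialRings

open MonomialRings

/-- **Lemma (the correspondence `D(cL_I) ↔ sat(M)`).**
Let `M` be the minimal generating set of a monomial ideal `I`.  Then `N ↦ M_N` is a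
bijection from `D(cL_I)` onto `sat(M)`, with inverse sending a saturated set `S` with
connected components `S₁,…,S_r` to `N = {m_{S₁},…,m_{S_r}}`; moreover `m_{M_N} = m_N`,
`c(M_N) = |N|`, and the `M_l`, `l ∈ N`, are exactly the connected components of
`M_N`. -/
theorem discrete_sets_correspond_to_saturated_sets
    (t : ℕ)
    (M : Finset (Mon (Fin t)))
    (hmin : IsAntichain' M)
    (hdeg : ∀ m ∈ M, 2 ≤ mdeg m) :
    Set.BijOn (divisorsInSet M) ↑(discreteSubsets (cLcmLattice M)) ↑(satSets M) ∧
    (∀ S ∈ satSets M, (components S).image mlcm ∈ discreteSubsets (cLcmLattice M) ∧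
        divisorsInSet M ((components S).image mlcm) = S) ∧
    (∀ N ∈ discreteSubsets (cLcmLattice M),
        (components (divisorsInSet M N)).image mlcm = N ∧
        mlcm (divisorsInSet M N) = mlcm N ∧
        ncomp (divisorsInSet M N) = N.card ∧
        components (divisorsInSet M N) = N.image (fun l => divisorsIn M l)) := by
  have h0 : ∀ m ∈ M, m ≠ 0 := by
    rintro m hm rfl
    simpa [mdeg] using hdeg 0 hm
  have hsat : ∀ S ∈ satSets M, (components S).image mlcm ∈ discreteSubsets (cLcmLattice M) ∧
      divisorsInSet M ((components S).image mlcm) = S := by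
    intro S hS
    obtain ⟨hne, h⟩ := mem_satSets.1 hS
    constructor
    · convert h.image_mlcm_components_mem h0 hne
    · convert h.divisorsInSet_image_mlcm_components
  have hinv : ∀ N ∈ discreteSubsets (cLcmLattice M),
      (components (divisorsInSet M N)).image mlcm = N := by
    intro N hN
    obtain ⟨hNM, -, hd⟩ := mem_discreteSubsets.1 hN
    convert hd.image_mlcm_components_divisorsInSet hNM
  refine ⟨⟨fun N hN => divisorsInSet_mem_satSets hN, fun N hN N' hN' h => ?_,
    fun S hS => ⟨_, hsat S hS⟩⟩, hsat, fun N hN => ?_⟩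
  · rw [← hinv N hN, ← hinv N' hN', h]
  · obtain ⟨hNM, -, hd⟩ := mem_discreteSubsets.1 hN
    refine ⟨hinv N hN, mlcm_divisorsInSet fun l hl => (mem_cLcmLattice.1 (hNM hl)).1,
      hd.ncomp_divisorsInSet hNM, ?_⟩
    convert hd.components_divisorsInSet hNM
end
end

section
/- Let I be a monomial ideal in Q = k[x_1,…,x_t] with minimal generating set M, let d_i = max_{m ∈ M} deg_{x_i}(m), and for m = x_1^{a_1}⋯x_t^{a_t} ∈ M let m' = ∏_{i=1}^t ∏_{j=1}^{a_i} x_{i,j} in Q' = k[x_{i,j} : 1 ≤ i ≤ t, 1 ≤ j ≤ d_i]. Then M' = {m' : m ∈ M} minimally generates an ideal I' of Q', and the map M' → M, m' ↦ m, extends to a map f : L_{I'} → L_I characterized by the property that x_{i,j} divides m ∈ L_{I'} if and only if x_i^j divides f(m); this f is an equivalence, i.e. an isomorphism of partially ordered graphs L_{I'} → L_I. -/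
noncomputable section
attribute [local instance] Classical.propDecidable

namespace MonomialRings

/-- `dᵢ = max_{m ∈ M} deg_{xᵢ}(m)`. -/
def polarDeg {t : ℕ} (M : Finset (Mon (Fin t))) (i : Fin t) : ℕ :=
  M.sup (fun m => m i)

/-- Fröberg's polarization `m ↦ m' = ∏ᵢ ∏_{j=1}^{aᵢ} x_{i,j}` of a monomial
`m = x₁^{a₁}⋯x_t^{a_t}`; the variable `x_{i,j}` (`1 ≤ j ≤ dᵢ`) is indexed by
`⟨i, j-1⟩ : Σ i, Fin dᵢ`. -/
def polarize {t : ℕ} (M : Finset (Mon (Fin t))) (m : Mon (Fin t)) :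
    Mon ((i : Fin t) × Fin (polarDeg M i)) :=
  fun p => if (p.2 : ℕ) < m p.1 then 1 else 0

end MonomialRings

namespace MonomialRings

variable {t : ℕ} {M : Finset (Mon (Fin t))}

/-- The inverse of polarization: the exponent of `xᵢ` is the largest `j` such that `x_{i,j}`
divides the given monomial. -/
def depolarize (M : Finset (Mon (Fin t))) (l : Mon ((i : Fin t) × Fin (polarDeg M i))) :
    Mon (Fin t) :=
  fun i => Finset.univ.sup fun j : Fin (polarDeg M i) => if l ⟨i, j⟩ = 0 then 0 else (j : ℕ) + 1

theorem depolarize_polarize {a : Mon (Fin t)} (ha : a ≤ polarDeg M) :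
    depolarize M (polarize M a) = a := by
  funext i
  apply le_antisymm
  · refine Finset.sup_le fun j _ => ?_
    simp only [polarize]
    split_ifs <;> omega
  · rcases Nat.eq_zero_or_pos (a i) with h | h
    · omega
    · have hd : a i ≤ polarDeg M i := ha i
      let j : Fin (polarDeg M i) := ⟨a i - 1, by omega⟩
      refine le_trans ?_ (Finset.le_sup (Finset.mem_univ j))
      have hj : (j : ℕ) = a i - 1 := rfl
      have hlt : (j : ℕ) < a i := by omega
      simp only [polarize, hlt, if_true, one_ne_zero, if_false]
      omega

theorem polarize_mono {a b : Mon (Fin t)} (h : a ≤ b) : polarize M a ≤ polarize M b := by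
  rintro ⟨i, j⟩
  have hi : a i ≤ b i := h i
  simp only [polarize]
  split_ifs <;> omega

theorem polarize_le_polarize_iff {a b : Mon (Fin t)} (ha : a ≤ polarDeg M) :
    polarize M a ≤ polarize M b ↔ a ≤ b := by
  refine ⟨fun h i => ?_, polarize_mono⟩
  by_contra! hlt
  have hd : a i ≤ polarDeg M i := ha i
  have hp := h ⟨i, ⟨b i, hlt.trans_le hd⟩⟩
  simp [polarize, hlt] at hp

theorem polarize_injOn : Set.InjOn (polarize M) {a | a ≤ polarDeg M} := fun a ha b hb h => by
  rw [← depolarize_polarize ha, h, depolarize_polarize hb]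

theorem ncf_polarize_iff {a b : Mon (Fin t)} (ha : a ≤ polarDeg M) :
    NCF (polarize M a) (polarize M b) ↔ NCF a b := by
  constructor
  · rintro ⟨⟨i, j⟩, h₁, h₂⟩
    simp only [polarize, ne_eq, ite_eq_right_iff, one_ne_zero, imp_false, not_not] at h₁ h₂
    exact ⟨i, by omega, by omega⟩
  · rintro ⟨i, h₁, h₂⟩
    have hd : a i ≤ polarDeg M i := ha i
    refine ⟨⟨i, ⟨0, by omega⟩⟩, ?_, ?_⟩ <;> simpa [polarize, Nat.pos_iff_ne_zero]

theorem polarize_mlcm (S : Finset (Mon (Fin t))) :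
    polarize M (mlcm S) = mlcm (S.image (polarize M)) := by
  rw [mlcm, mlcm, Finset.sup_image]
  refine Finset.apply_sup_eq_sup_comp (polarize M) (fun a b => ?_) ?_
  · funext p
    simp only [polarize, Pi.sup_apply]
    split_ifs <;> simp_all
  · funext p
    simp [polarize]

theorem mem_lcmLattice {σ : Type*} {N : Finset (Mon σ)} {a : Mon σ} :
    a ∈ lcmLattice N ↔ ∃ S ⊆ N, mlcm S = a := by
  simp [lcmLattice]

theorem le_polarDeg {m : Mon (Fin t)} (hm : m ∈ M) : m ≤ polarDeg M := fun i =>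
  Finset.le_sup (f := fun m : Mon (Fin t) => m i) hm

theorem le_polarDeg_of_mem_lcmLattice {a : Mon (Fin t)} (ha : a ∈ lcmLattice M) :
    a ≤ polarDeg M := by
  obtain ⟨S, hS, rfl⟩ := mem_lcmLattice.mp ha
  exact Finset.sup_le fun m hm => le_polarDeg (hS hm)

theorem lcmLattice_image_polarize :
    lcmLattice (M.image (polarize M)) = (lcmLattice M).image (polarize M) := by
  ext l
  simp only [Finset.mem_image, mem_lcmLattice, exists_exists_and_eq_and, polarize_mlcm]
  constructor
  · rintro ⟨T, hT, rfl⟩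
    obtain ⟨S, hS, rfl⟩ := Finset.subset_image_iff.mp hT
    exact ⟨S, hS, rfl⟩
  · rintro ⟨S, hS, rfl⟩
    exact ⟨_, Finset.image_subset_image hS, rfl⟩

end MonomialRings

open MonomialRings

/-- **Lemma (Fröberg's polarization gives an equivalence of lcm-lattices).**
Let `I` be a monomial ideal of `Q = k[x₁,…,x_t]` with minimal generating set `M`.  Then
`M' = {m' : m ∈ M}` minimally generates an ideal `I'` of `Q' = k[x_{i,j}]` (i.e. `M'` is
an antichain), and the map `M' → M`, `m' ↦ m`, extends to a map `f : L_{I'} → L_I`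
characterized by the property that `x_{i,j}` divides `l ∈ L_{I'}` if and only if `xᵢʲ`
divides `f(l)`; this `f` is an equivalence, i.e. an isomorphism of partially ordered
graphs `L_{I'} → L_I`. -/
theorem polarization_is_equivalence
    (t : ℕ)
    (M : Finset (Mon (Fin t)))
    (hmin : IsAntichain' M) :
    IsAntichain' (M.image (polarize M)) ∧
    ∃ f : Mon ((i : Fin t) × Fin (polarDeg M i)) → Mon (Fin t),
      (∀ l ∈ lcmLattice (M.image (polarize M)), ∀ (i : Fin t) (j : Fin (polarDeg M i)),
          (1 ≤ l ⟨i, j⟩ ↔ (j : ℕ) + 1 ≤ f l i)) ∧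
      (∀ m ∈ M, f (polarize M m) = m) ∧
      IsEquivalence (M.image (polarize M)) M f := by
  have hle {a : Mon (Fin t)} (ha : a ∈ lcmLattice M) := le_polarDeg_of_mem_lcmLattice ha
  refine ⟨?_, depolarize M, ?_, fun m hm => depolarize_polarize (le_polarDeg hm),
    ?_, ?_, ?_⟩
  · simp only [IsAntichain', Finset.forall_mem_image]
    intro m hm n hn h
    rw [hmin m hm n hn ((polarize_le_polarize_iff (le_polarDeg hm)).mp h)]
  · simp only [lcmLattice_image_polarize, Finset.forall_mem_image]
    intro a ha i j
    rw [depolarize_polarize (hle ha)]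
    simp only [polarize]
    split_ifs <;> omega
  · rw [lcmLattice_image_polarize, Finset.coe_image]
    have hleft : Set.LeftInvOn (depolarize M) (polarize M) ↑(lcmLattice M) :=
      fun a ha => depolarize_polarize (hle ha)
    refine ⟨?_, ?_, fun a ha => ⟨polarize M a, Set.mem_image_of_mem _ ha, hleft ha⟩⟩
    · rintro _ ⟨a, ha, rfl⟩
      rwa [hleft ha]
    · rintro _ ⟨a, ha, rfl⟩ _ ⟨b, hb, rfl⟩ h
      rw [hleft ha, hleft hb] at h
      rw [h]
  · simp only [lcmLattice_image_polarize, Finset.forall_mem_image]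
    intro a ha b hb
    rw [depolarize_polarize (hle ha), depolarize_polarize (hle hb),
      polarize_le_polarize_iff (hle ha)]
  · simp only [lcmLattice_image_polarize, Finset.forall_mem_image]
    intro a ha b hb
    rw [depolarize_polarize (hle ha), depolarize_polarize (hle hb), mAdj, mAdj,
      ncf_polarize_iff (hle ha), Ne, polarize_injOn.eq_iff (hle ha) (hle hb)]
end
end
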